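/- Case 12 of Theorem 1.2: the hypergeometric group Γ(f,g) generated by the companion matrices A and B of f(x) = x^5 - x^4 + x^3 - x^2 + x - 1 and g(x) = x^5 + x^4 - x^3 - x^2 + x + 1 is an arithmetic subgroup of the integral orthogonal group O_Q(ℤ): Γ(f,g) is contained in O_Q(ℤ) (in particular Aᵀ·Q·A = Q and Bᵀ·Q·B = Q), and Γ(f,g) has finite index in O_Q(ℤ). -/

import Mathlib

open Matrix

/-- The companion matrix `A` of `f(x) = x^5 - x^4 + x^3 - x^2 + x - 1`. -/
def matA : Matrix (Fin 5) (Fin 5) ℤ :=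
  !![(0 : ℤ), 0, 0, 0, 1; 1, 0, 0, 0, -1; 0, 1, 0, 0, 1; 0, 0, 1, 0, -1; 0, 0, 0, 1, 1]

/-- The companion matrix `B` of `g(x) = x^5 + x^4 - x^3 - x^2 + x + 1`. -/
def matB : Matrix (Fin 5) (Fin 5) ℤ :=
  !![(0 : ℤ), 0, 0, 0, -1; 1, 0, 0, 0, -1; 0, 1, 0, 0, 1; 0, 0, 1, 0, 1; 0, 0, 0, 1, -1]

/-- The symmetric integer matrix `Q` of the quadratic form preserved by `Γ(f,g)`. -/
def matQ : Matrix (Fin 5) (Fin 5) ℤ :=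
  !![(1 : ℤ), 2, 1, -1, 1; 2, 1, 2, 1, -1; 1, 2, 1, 2, 1; -1, 1, 2, 1, 2; 1, -1, 1, 2, 1]

/-- The integral orthogonal group `O_Q(ℤ)` of a matrix `Q`, as the subgroup of `GL₅(ℤ)`
consisting of all `M` with `Mᵀ * Q * M = Q`. -/
def orthogonalSubgroup (Q : Matrix (Fin 5) (Fin 5) ℤ) : Subgroup (GL (Fin 5) ℤ) where
  carrier := { M : GL (Fin 5) ℤ |
      (M : Matrix (Fin 5) (Fin 5) ℤ)ᵀ * Q * (M : Matrix (Fin 5) (Fin 5) ℤ) = Q }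
  one_mem' := by simp
  mul_mem' := by
    intro a b ha hb
    simp only [Set.mem_setOf_eq, Units.val_mul, transpose_mul] at ha hb ⊢
    calc ((b : Matrix (Fin 5) (Fin 5) ℤ)ᵀ * (a : Matrix (Fin 5) (Fin 5) ℤ)ᵀ) * Q *
          ((a : Matrix (Fin 5) (Fin 5) ℤ) * (b : Matrix (Fin 5) (Fin 5) ℤ))
        = (b : Matrix (Fin 5) (Fin 5) ℤ)ᵀ *
            ((a : Matrix (Fin 5) (Fin 5) ℤ)ᵀ * Q * (a : Matrix (Fin 5) (Fin 5) ℤ)) *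
            (b : Matrix (Fin 5) (Fin 5) ℤ) := by
          simp only [mul_assoc]
      _ = Q := by rw [ha, hb]
  inv_mem' := by
    intro a ha
    simp only [Set.mem_setOf_eq] at ha ⊢
    calc ((a⁻¹ : GL (Fin 5) ℤ) : Matrix (Fin 5) (Fin 5) ℤ)ᵀ * Q *
          ((a⁻¹ : GL (Fin 5) ℤ) : Matrix (Fin 5) (Fin 5) ℤ)
        = ((a⁻¹ : GL (Fin 5) ℤ) : Matrix (Fin 5) (Fin 5) ℤ)ᵀ *
            ((a : Matrix (Fin 5) (Fin 5) ℤ)ᵀ * Q * (a : Matrix (Fin 5) (Fin 5) ℤ)) *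
            ((a⁻¹ : GL (Fin 5) ℤ) : Matrix (Fin 5) (Fin 5) ℤ) := by rw [ha]
      _ = ((a : Matrix (Fin 5) (Fin 5) ℤ) *
            ((a⁻¹ : GL (Fin 5) ℤ) : Matrix (Fin 5) (Fin 5) ℤ))ᵀ * Q *
          ((a : Matrix (Fin 5) (Fin 5) ℤ) *
            ((a⁻¹ : GL (Fin 5) ℤ) : Matrix (Fin 5) (Fin 5) ℤ)) := by
          simp only [transpose_mul, mul_assoc]
      _ = Q := by rw [Units.mul_inv]; simp

/-! ### Integer 5 × 5 matrices in a form the kernel evaluates quickly -/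

/-- Integer row vectors of length five. -/
structure V5 where
  a : ℤ
  b : ℤ
  c : ℤ
  d : ℤ
  e : ℤ

/-- Integer 5 × 5 matrices, stored by rows. -/
structure M5 where
  p : V5
  q : V5
  r : V5
  s : V5
  t : V5

/-- Row vector times matrix. -/
def V5.vm (x : V5) (M : M5) : V5 :=
  ⟨x.a * M.p.a + x.b * M.q.a + x.c * M.r.a + x.d * M.s.a + x.e * M.t.a,
   x.a * M.p.b + x.b * M.q.b + x.c * M.r.b + x.d * M.s.b + x.e * M.t.b,
   x.a * M.p.c + x.b * M.q.c + x.c * M.r.c + x.d * M.s.c + x.e * M.t.c,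
   x.a * M.p.d + x.b * M.q.d + x.c * M.r.d + x.d * M.s.d + x.e * M.t.d,
   x.a * M.p.e + x.b * M.q.e + x.c * M.r.e + x.d * M.s.e + x.e * M.t.e⟩

/-- Matrix product. -/
def M5.mul (X Y : M5) : M5 := ⟨X.p.vm Y, X.q.vm Y, X.r.vm Y, X.s.vm Y, X.t.vm Y⟩

/-- Identity matrix. -/
def M5.one : M5 :=
  ⟨⟨1, 0, 0, 0, 0⟩, ⟨0, 1, 0, 0, 0⟩, ⟨0, 0, 1, 0, 0⟩, ⟨0, 0, 0, 1, 0⟩, ⟨0, 0, 0, 0, 1⟩⟩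

/-- Boolean equality of vectors. -/
def V5.eqb (x y : V5) : Bool :=
  decide (x.a = y.a) && (decide (x.b = y.b) && (decide (x.c = y.c) &&
    (decide (x.d = y.d) && decide (x.e = y.e))))

/-- Boolean equality of matrices. -/
def M5.eqb (X Y : M5) : Bool :=
  X.p.eqb Y.p && (X.q.eqb Y.q && (X.r.eqb Y.r && (X.s.eqb Y.s && X.t.eqb Y.t)))

theorem V5.eq_of_eqb {x y : V5} (h : x.eqb y = true) : x = y := by
  cases x; cases y
  simp only [V5.eqb, Bool.and_eq_true, decide_eq_true_eq] at h
  simp [h]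

theorem M5.eq_of_eqb {X Y : M5} (h : X.eqb Y = true) : X = Y := by
  cases X; cases Y
  simp only [M5.eqb, Bool.and_eq_true] at h
  obtain ⟨h1, h2, h3, h4, h5⟩ := h
  simp [V5.eq_of_eqb h1, V5.eq_of_eqb h2, V5.eq_of_eqb h3, V5.eq_of_eqb h4, V5.eq_of_eqb h5]

/-- The Mathlib matrix attached to an `M5`. -/
def M5.toMat (X : M5) : Matrix (Fin 5) (Fin 5) ℤ :=
  !![X.p.a, X.p.b, X.p.c, X.p.d, X.p.e; X.q.a, X.q.b, X.q.c, X.q.d, X.q.e;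
     X.r.a, X.r.b, X.r.c, X.r.d, X.r.e; X.s.a, X.s.b, X.s.c, X.s.d, X.s.e;
     X.t.a, X.t.b, X.t.c, X.t.d, X.t.e]

theorem M5.toMat_mul (X Y : M5) : (X.mul Y).toMat = X.toMat * Y.toMat := by
  ext i j
  fin_cases i <;> fin_cases j <;>
    simp [M5.toMat, M5.mul, V5.vm, Matrix.mul_apply, Fin.sum_univ_five]

theorem M5.toMat_one : M5.one.toMat = 1 := by
  ext i j
  fin_cases i <;> fin_cases j <;> simp [M5.toMat, M5.one]

/-- Evaluate a word in a list of letters. -/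
def evalW (L : List M5) : List ℕ → M5
  | [] => M5.one
  | k :: w => (L.getD k M5.one).mul (evalW L w)

/-! ### Membership of explicit matrices in subgroups of `GL₅(ℤ)` -/

/-- The explicit matrix `X` is (the matrix of) an element of `H`. -/
def InH (H : Subgroup (GL (Fin 5) ℤ)) (X : M5) : Prop :=
  ∃ g ∈ H, (g : Matrix (Fin 5) (Fin 5) ℤ) = X.toMat

theorem InH.mono {H K : Subgroup (GL (Fin 5) ℤ)} (h : H ≤ K) {X : M5} (hX : InH H X) :
    InH K X := by
  obtain ⟨g, hg, e⟩ := hX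
  exact ⟨g, h hg, e⟩

theorem InH.one (H : Subgroup (GL (Fin 5) ℤ)) : InH H M5.one :=
  ⟨1, H.one_mem, by rw [M5.toMat_one]; rfl⟩

theorem InH.mul {H : Subgroup (GL (Fin 5) ℤ)} {X Y : M5} (hX : InH H X) (hY : InH H Y) :
    InH H (X.mul Y) := by
  obtain ⟨g, hg, e⟩ := hX
  obtain ⟨k, hk, f⟩ := hY
  exact ⟨g * k, H.mul_mem hg hk, by rw [M5.toMat_mul, Units.val_mul, e, f]⟩

theorem InH.left_div {H : Subgroup (GL (Fin 5) ℤ)} {X Y Z : M5} (hX : InH H X) (hZ : InH H Z)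
    (h : (X.mul Y).eqb Z = true) : InH H Y := by
  obtain ⟨g, hg, e⟩ := hX
  obtain ⟨k, hk, f⟩ := hZ
  refine ⟨g⁻¹ * k, H.mul_mem (H.inv_mem hg) hk, ?_⟩
  have h' := congrArg M5.toMat (M5.eq_of_eqb h)
  rw [M5.toMat_mul, ← e, ← f] at h'
  rw [Units.val_mul, ← h', ← mul_assoc, Units.inv_mul, one_mul]

theorem InH.mem {H : Subgroup (GL (Fin 5) ℤ)} {X : M5} (hX : InH H X) {g : GL (Fin 5) ℤ}
    (hg : (g : Matrix (Fin 5) (Fin 5) ℤ) = X.toMat) : g ∈ H := by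
  obtain ⟨k, hk, e⟩ := hX
  have : g = k := Units.ext (by rw [hg, e])
  rwa [this]

theorem InH.word {H : Subgroup (GL (Fin 5) ℤ)} {L : List M5} (hL : ∀ X ∈ L, InH H X)
    (w : List ℕ) : InH H (evalW L w) := by
  induction w with
  | nil => exact InH.one H
  | cons k w ih =>
    refine InH.mul ?_ ih
    by_cases hk : k < L.length
    · rw [List.getD_eq_getElem _ _ hk]
      exact hL _ (List.getElem_mem hk)
    · rw [List.getD_eq_default _ _ (not_lt.mp hk)]
      exact InH.one H

theorem InH.of_word {H : Subgroup (GL (Fin 5) ℤ)} {L : List M5} (hL : ∀ X ∈ L, InH H X)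
    (w : List ℕ) {X : M5} (h : (evalW L w).eqb X = true) : InH H X := by
  rw [← M5.eq_of_eqb h]
  exact InH.word hL w

/-- Check that the members of a list are the values of the given words. -/
def chkWords (L : List M5) : List M5 → List (List ℕ) → Bool
  | [], _ => true
  | X :: Xs, w :: ws => (evalW L w).eqb X && chkWords L Xs ws
  | _ :: _, [] => false

theorem InH.of_chkWords {H : Subgroup (GL (Fin 5) ℤ)} {L : List M5} (hL : ∀ X ∈ L, InH H X) :
    ∀ (Xs : List M5) (ws : List (List ℕ)), chkWords L Xs ws = true → ∀ X ∈ Xs, InH H X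
  | [], _, _ => by simp
  | Y :: Xs, [], h => by simp [chkWords] at h
  | Y :: Xs, w :: ws, h => by
    simp only [chkWords, Bool.and_eq_true] at h
    intro X hX
    rcases List.mem_cons.mp hX with rfl | hX
    · exact InH.of_word hL w h.1
    · exact InH.of_chkWords hL Xs ws h.2 X hX

/-- The elements of `GL₅(ℤ)` with matrix in a given list. -/
def listSet (S : List M5) : Set (GL (Fin 5) ℤ) :=
  {g | ∃ X ∈ S, (g : Matrix (Fin 5) (Fin 5) ℤ) = X.toMat}

/-- Every matrix in the list has a two-sided inverse in the list. -/
def chkInv (S : List M5) : Bool :=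
  S.all fun X => S.any fun Y => (X.mul Y).eqb M5.one && (Y.mul X).eqb M5.one

theorem chkInv_spec {S : List M5} (h : chkInv S = true) {X : M5} (hX : X ∈ S) :
    ∃ Y ∈ S, X.toMat * Y.toMat = 1 ∧ Y.toMat * X.toMat = 1 := by
  simp only [chkInv, List.all_eq_true, List.any_eq_true, Bool.and_eq_true] at h
  obtain ⟨Y, hY, h1, h2⟩ := h X hX
  refine ⟨Y, hY, ?_, ?_⟩
  · rw [← M5.toMat_mul, M5.eq_of_eqb h1, M5.toMat_one]
  · rw [← M5.toMat_mul, M5.eq_of_eqb h2, M5.toMat_one]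

theorem InH.gen {S : List M5} (h : chkInv S = true) {X : M5} (hX : X ∈ S) :
    InH (Subgroup.closure (listSet S)) X := by
  obtain ⟨Y, -, h1, h2⟩ := chkInv_spec h hX
  exact ⟨⟨X.toMat, Y.toMat, h1, h2⟩, Subgroup.subset_closure ⟨X, hX, rfl⟩, rfl⟩

theorem closure_listSet_le {S : List M5} {K : Subgroup (GL (Fin 5) ℤ)}
    (h : ∀ X ∈ S, InH K X) : Subgroup.closure (listSet S) ≤ K := by
  rw [Subgroup.closure_le]
  rintro g ⟨X, hX, hg⟩
  exact (h X hX).mem hg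

/-! ### Coset tables -/

/-- One row of a coset table: `t * s = w * t'` for each `s` in the list. -/
def chkRow (L T : List M5) (t : M5) : List M5 → List (List ℕ × ℕ) → Bool
  | [], _ => true
  | s :: S, (w, k) :: ds =>
    (t.mul s).eqb ((evalW L w).mul (T.getD k M5.one)) && chkRow L T t S ds
  | _ :: _, [] => false

/-- All rows of a coset table. -/
def chkTable (L T S : List M5) : List M5 → List (List (List ℕ × ℕ)) → Bool
  | [], _ => true
  | t :: Ts, d :: ds => chkRow L T t S d && chkTable L T S Ts ds
  | _ :: _, [] => false

theorem chkRow_spec {L T : List M5} {t : M5} :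
    ∀ (S : List M5) (d : List (List ℕ × ℕ)), chkRow L T t S d = true →
      ∀ s ∈ S, ∃ w k, t.mul s = (evalW L w).mul (T.getD k M5.one)
  | [], _, _ => by simp
  | _ :: _, [], h => by simp [chkRow] at h
  | s' :: S, (w, k) :: ds, h => by
    simp only [chkRow, Bool.and_eq_true] at h
    intro s hs
    rcases List.mem_cons.mp hs with rfl | hs
    · exact ⟨w, k, M5.eq_of_eqb h.1⟩
    · exact chkRow_spec S ds h.2 s hs

theorem chkTable_spec {L T S : List M5} :
    ∀ (Ts : List M5) (d : List (List (List ℕ × ℕ))), chkTable L T S Ts d = true →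
      ∀ t ∈ Ts, ∀ s ∈ S, ∃ w k, t.mul s = (evalW L w).mul (T.getD k M5.one)
  | [], _, _ => by simp
  | _ :: _, [], h => by simp [chkTable] at h
  | t' :: Ts, d :: ds, h => by
    simp only [chkTable, Bool.and_eq_true] at h
    intro t ht
    rcases List.mem_cons.mp ht with rfl | ht
    · exact chkRow_spec S d h.1
    · exact chkTable_spec Ts ds h.2 t ht

theorem relIndex_of_table {H : Subgroup (GL (Fin 5) ℤ)} {L S : List M5} (T : List M5)
    (hL : ∀ X ∈ L, InH H X) (hS : chkInv S = true)
    (d : List (List (List ℕ × ℕ)))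
    (hd : chkTable L (M5.one :: T) S (M5.one :: T) d = true) :
    H.relIndex (Subgroup.closure (listSet S)) ≠ 0 := by
  have step : ∀ t ∈ M5.one :: T, ∀ s ∈ S, ∃ h ∈ H, ∃ t' ∈ M5.one :: T,
      t.toMat * s.toMat = (h : Matrix (Fin 5) (Fin 5) ℤ) * t'.toMat := by
    intro t ht s hs
    obtain ⟨w, k, e⟩ := chkTable_spec _ d hd t ht s hs
    obtain ⟨h, hh, eh⟩ := InH.word hL w
    refine ⟨h, hh, (M5.one :: T).getD k M5.one, ?_, ?_⟩
    · by_cases hk : k < (M5.one :: T).length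
      · rw [List.getD_eq_getElem _ _ hk]
        exact List.getElem_mem hk
      · rw [List.getD_eq_default _ _ (not_lt.mp hk)]
        simp
    · rw [← M5.toMat_mul, e, M5.toMat_mul, eh]
  have key : ∀ g ∈ Subgroup.closure (listSet S), ∃ t : {t // t ∈ M5.one :: T}, ∃ h ∈ H,
      (g : Matrix (Fin 5) (Fin 5) ℤ) = (h : Matrix (Fin 5) (Fin 5) ℤ) * t.1.toMat := by
    have mulstep : ∀ (x y : GL (Fin 5) ℤ) (X : M5), X ∈ S →
        (y : Matrix (Fin 5) (Fin 5) ℤ) = X.toMat →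
        (∃ t : {t // t ∈ M5.one :: T}, ∃ h ∈ H,
          (x : Matrix (Fin 5) (Fin 5) ℤ) = (h : Matrix (Fin 5) (Fin 5) ℤ) * t.1.toMat) →
        (∃ t : {t // t ∈ M5.one :: T}, ∃ h ∈ H,
          ((x * y : GL (Fin 5) ℤ) : Matrix (Fin 5) (Fin 5) ℤ) =
            (h : Matrix (Fin 5) (Fin 5) ℤ) * t.1.toMat) := by
      rintro x y X hX hy ⟨t, h, hh, e⟩
      obtain ⟨h', hh', t', ht', e'⟩ := step t.1 t.2 X hX
      refine ⟨⟨t', ht'⟩, h * h', H.mul_mem hh hh', ?_⟩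
      rw [Units.val_mul, Units.val_mul, e, hy, mul_assoc, e', mul_assoc]
    intro g hg
    induction hg using Subgroup.closure_induction_right with
    | one => exact ⟨⟨M5.one, by simp⟩, 1, H.one_mem, by simp [M5.toMat_one]⟩
    | mul_right x hx y hy ih =>
      obtain ⟨X, hX, e⟩ := hy
      exact mulstep x y X hX e ih
    | mul_inv_cancel x hx y hy ih =>
      obtain ⟨X, hX, e⟩ := hy
      obtain ⟨Y, hY, h1, h2⟩ := chkInv_spec hS hX
      refine mulstep x y⁻¹ Y hY ?_ ih
      have : (y⁻¹ : GL (Fin 5) ℤ) = ⟨Y.toMat, X.toMat, h2, h1⟩ := by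
        rw [inv_eq_iff_eq_inv]
        exact Units.ext e
      rw [this]
  have fin : Finite (Subgroup.closure (listSet S) ⧸
      H.subgroupOf (Subgroup.closure (listSet S))) := by
    choose f hf using key
    have : Finite {t // t ∈ M5.one :: T} := List.finite_toSet (M5.one :: T)
    refine Finite.of_injective
      (fun q : Subgroup.closure (listSet S) ⧸ H.subgroupOf (Subgroup.closure (listSet S)) =>
        f (q.out⁻¹ : Subgroup.closure (listSet S)) (q.out⁻¹).2) ?_
    intro q q' hqq
    obtain ⟨h, hh, e⟩ := hf (q.out⁻¹ : Subgroup.closure (listSet S)) (q.out⁻¹).2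
    obtain ⟨h', hh', e'⟩ := hf (q'.out⁻¹ : Subgroup.closure (listSet S)) (q'.out⁻¹).2
    simp only at hqq
    rw [hqq] at e
    have e3 : ((q.out⁻¹ : Subgroup.closure (listSet S)) : GL (Fin 5) ℤ) =
        h * h'⁻¹ * ((q'.out⁻¹ : Subgroup.closure (listSet S)) : GL (Fin 5) ℤ) := by
      apply Units.ext
      rw [Units.val_mul, Units.val_mul, e, e', mul_assoc, ← mul_assoc _ _ (M5.toMat _),
        Units.inv_mul, one_mul]
    rw [← QuotientGroup.out_eq' q, ← QuotientGroup.out_eq' q', QuotientGroup.eq,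
      Subgroup.mem_subgroupOf, Subgroup.coe_mul, e3]
    have : h * h'⁻¹ * ((q'.out⁻¹ : Subgroup.closure (listSet S)) : GL (Fin 5) ℤ) *
        (q'.out : GL (Fin 5) ℤ) = h * h'⁻¹ := by
      rw [mul_assoc, ← Subgroup.coe_mul, inv_mul_cancel, Subgroup.coe_one, mul_one]
    rw [this]
    exact H.mul_mem hh (H.inv_mem hh')
  exact (Subgroup.finiteIndex_of_finite_quotient
    (H := H.subgroupOf (Subgroup.closure (listSet S)))).index_ne_zero

/-! ### Explicit data: generators, intermediate groups and coset tables -/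

/-- `B` in hyperbolic coordinates. -/
def mB : M5 :=
  ⟨⟨0, 1, 0, 0, 0⟩, ⟨1, 0, 0, -1, 0⟩, ⟨0, 0, 0, 1, 0⟩, ⟨0, 1, 1, 0, 0⟩, ⟨0, 0, 0, 0, -1⟩⟩

/-- The inverse of `B` in hyperbolic coordinates. -/
def mBi : M5 :=
  ⟨⟨0, 1, 1, 0, 0⟩, ⟨1, 0, 0, 0, 0⟩, ⟨-1, 0, 0, 1, 0⟩, ⟨0, 0, 1, 0, 0⟩, ⟨0, 0, 0, 0, -1⟩⟩

/-- The reflection `A⁻¹ B` in hyperbolic coordinates. -/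
def mC : M5 :=
  ⟨⟨1, -2, -2, 2, -6⟩, ⟨0, 1, 0, 0, 0⟩, ⟨0, 2, 3, -2, 6⟩, ⟨0, -2, -2, 3, -6⟩, ⟨0, -2, -2, 2, -5⟩⟩

/-- Auxiliary involution number 1. -/
def ms1 : M5 :=
  ⟨⟨1, 0, 0, 0, 0⟩, ⟨0, 1, 0, 0, 0⟩, ⟨0, 0, 1, 0, 0⟩, ⟨0, 0, 0, 1, 0⟩, ⟨0, 0, 0, 0, -1⟩⟩

/-- Auxiliary involution number 2. -/
def ms2 : M5 :=
  ⟨⟨0, 1, 0, 0, 0⟩, ⟨1, 0, 0, 0, 0⟩, ⟨0, 0, 0, -1, 0⟩, ⟨0, 0, -1, 0, 0⟩, ⟨0, 0, 0, 0, 1⟩⟩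

/-- Auxiliary involution number 3. -/
def ms3 : M5 :=
  ⟨⟨0, 2, -1, 0, 0⟩, ⟨1, 0, 0, 1, 0⟩, ⟨1, 0, 0, 2, 0⟩, ⟨0, -1, 1, 0, 0⟩, ⟨0, 0, 0, 0, 1⟩⟩

/-- Auxiliary involution number 4. -/
def ms4 : M5 :=
  ⟨⟨0, -1, 0, 0, 0⟩, ⟨-1, 0, 0, 0, 0⟩, ⟨0, 0, 0, -1, 0⟩, ⟨0, 0, -1, 0, 0⟩, ⟨0, 0, 0, 0, -1⟩⟩

/-- Auxiliary involution number 5. -/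
def ms5 : M5 :=
  ⟨⟨1, 0, 0, 0, 0⟩, ⟨0, 1, 0, -2, 0⟩, ⟨-2, 0, -1, 0, 0⟩, ⟨0, 0, 0, -1, 0⟩, ⟨0, 0, 0, 0, 1⟩⟩

/-- Auxiliary involution number 6. -/
def ms6 : M5 :=
  ⟨⟨0, -1, 0, 1, 0⟩, ⟨0, 0, 1, 0, 0⟩, ⟨0, 1, 0, 0, 0⟩, ⟨1, 0, 1, 0, 0⟩, ⟨0, 0, 0, 0, 1⟩⟩

/-- Auxiliary involution number 7. -/
def ms7 : M5 :=
  ⟨⟨1, 0, 0, 0, 0⟩, ⟨0, 1, 0, 0, 0⟩, ⟨0, 0, 0, 1, 0⟩, ⟨0, 0, 1, 0, 0⟩, ⟨0, 0, 0, 0, -1⟩⟩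

/-- The twelve conjugates of the reflection under powers of `B`, then the powers of `B`. -/
def baseL : List M5 :=
  [⟨⟨1, -2, -2, 2, -6⟩, ⟨0, 1, 0, 0, 0⟩, ⟨0, 2, 3, -2, 6⟩, ⟨0, -2, -2, 3, -6⟩, ⟨0, -2, -2, 2, -5⟩⟩,
   ⟨⟨1, 0, 0, 0, 0⟩, ⟨0, 1, 0, 0, 0⟩, ⟨0, 0, 3, -2, 6⟩, ⟨0, 0, -2, 3, -6⟩, ⟨0, 0, -2, 2, -5⟩⟩,
   ⟨⟨1, 0, 0, 0, 0⟩, ⟨-2, 1, -2, 2, -6⟩, ⟨2, 0, 3, -2, 6⟩, ⟨-2, 0, -2, 3, -6⟩, ⟨-2, 0, -2, 2, -5⟩⟩,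
   ⟨⟨3, -2, 0, -2, 6⟩, ⟨-2, 3, 0, 2, -6⟩, ⟨2, -2, 1, -2, 6⟩, ⟨0, 0, 0, 1, 0⟩, ⟨-2, 2, 0, 2, -5⟩⟩,
   ⟨⟨3, -2, 0, 0, 6⟩, ⟨-2, 3, 0, 0, -6⟩, ⟨0, 0, 1, 0, 0⟩, ⟨0, 0, 0, 1, 0⟩, ⟨-2, 2, 0, 0, -5⟩⟩,
   ⟨⟨3, -2, -2, 0, 6⟩, ⟨-2, 3, 2, 0, -6⟩, ⟨0, 0, 1, 0, 0⟩, ⟨2, -2, -2, 1, 6⟩, ⟨-2, 2, 2, 0, -5⟩⟩,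
   ⟨⟨1, -2, -2, 2, 6⟩, ⟨0, 1, 0, 0, 0⟩, ⟨0, 2, 3, -2, -6⟩, ⟨0, -2, -2, 3, 6⟩, ⟨0, 2, 2, -2, -5⟩⟩,
   ⟨⟨1, 0, 0, 0, 0⟩, ⟨0, 1, 0, 0, 0⟩, ⟨0, 0, 3, -2, -6⟩, ⟨0, 0, -2, 3, 6⟩, ⟨0, 0, 2, -2, -5⟩⟩,
   ⟨⟨1, 0, 0, 0, 0⟩, ⟨-2, 1, -2, 2, 6⟩, ⟨2, 0, 3, -2, -6⟩, ⟨-2, 0, -2, 3, 6⟩, ⟨2, 0, 2, -2, -5⟩⟩,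
   ⟨⟨3, -2, 0, -2, -6⟩, ⟨-2, 3, 0, 2, 6⟩, ⟨2, -2, 1, -2, -6⟩, ⟨0, 0, 0, 1, 0⟩, ⟨2, -2, 0, -2, -5⟩⟩,
   ⟨⟨3, -2, 0, 0, -6⟩, ⟨-2, 3, 0, 0, 6⟩, ⟨0, 0, 1, 0, 0⟩, ⟨0, 0, 0, 1, 0⟩, ⟨2, -2, 0, 0, -5⟩⟩,
   ⟨⟨3, -2, -2, 0, -6⟩, ⟨-2, 3, 2, 0, 6⟩, ⟨0, 0, 1, 0, 0⟩, ⟨2, -2, -2, 1, -6⟩, ⟨2, -2, -2, 0, -5⟩⟩,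
   ⟨⟨0, 1, 0, 0, 0⟩, ⟨1, 0, 0, -1, 0⟩, ⟨0, 0, 0, 1, 0⟩, ⟨0, 1, 1, 0, 0⟩, ⟨0, 0, 0, 0, -1⟩⟩,
   ⟨⟨1, 0, 0, -1, 0⟩, ⟨0, 0, -1, 0, 0⟩, ⟨0, 1, 1, 0, 0⟩, ⟨1, 0, 0, 0, 0⟩, ⟨0, 0, 0, 0, 1⟩⟩,
   ⟨⟨0, 0, -1, 0, 0⟩, ⟨0, 0, 0, -1, 0⟩, ⟨1, 0, 0, 0, 0⟩, ⟨0, 1, 0, 0, 0⟩, ⟨0, 0, 0, 0, -1⟩⟩,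
   ⟨⟨0, 0, 0, -1, 0⟩, ⟨0, -1, -1, 0, 0⟩, ⟨0, 1, 0, 0, 0⟩, ⟨1, 0, 0, -1, 0⟩, ⟨0, 0, 0, 0, 1⟩⟩,
   ⟨⟨0, -1, -1, 0, 0⟩, ⟨-1, 0, 0, 0, 0⟩, ⟨1, 0, 0, -1, 0⟩, ⟨0, 0, -1, 0, 0⟩, ⟨0, 0, 0, 0, -1⟩⟩,
   ⟨⟨-1, 0, 0, 0, 0⟩, ⟨0, -1, 0, 0, 0⟩, ⟨0, 0, -1, 0, 0⟩, ⟨0, 0, 0, -1, 0⟩, ⟨0, 0, 0, 0, 1⟩⟩,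
   ⟨⟨0, -1, 0, 0, 0⟩, ⟨-1, 0, 0, 1, 0⟩, ⟨0, 0, 0, -1, 0⟩, ⟨0, -1, -1, 0, 0⟩, ⟨0, 0, 0, 0, -1⟩⟩,
   ⟨⟨-1, 0, 0, 1, 0⟩, ⟨0, 0, 1, 0, 0⟩, ⟨0, -1, -1, 0, 0⟩, ⟨-1, 0, 0, 0, 0⟩, ⟨0, 0, 0, 0, 1⟩⟩,
   ⟨⟨0, 0, 1, 0, 0⟩, ⟨0, 0, 0, 1, 0⟩, ⟨-1, 0, 0, 0, 0⟩, ⟨0, -1, 0, 0, 0⟩, ⟨0, 0, 0, 0, -1⟩⟩,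
   ⟨⟨0, 0, 0, 1, 0⟩, ⟨0, 1, 1, 0, 0⟩, ⟨0, -1, 0, 0, 0⟩, ⟨-1, 0, 0, 1, 0⟩, ⟨0, 0, 0, 0, 1⟩⟩,
   ⟨⟨0, 1, 1, 0, 0⟩, ⟨1, 0, 0, 0, 0⟩, ⟨-1, 0, 0, 1, 0⟩, ⟨0, 0, 1, 0, 0⟩, ⟨0, 0, 0, 0, -1⟩⟩]

/-- Generators of the hypergeometric group. -/
def genS0 : List M5 := [mB, mBi, mC]

/-- Generators of intermediate group number 1. -/
def genS1 : List M5 := [mB, mBi, mC, ms1]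

/-- Generators of intermediate group number 2. -/
def genS2 : List M5 := [mB, mBi, mC, ms1, ms2]

/-- Generators of intermediate group number 3. -/
def genS3 : List M5 := [mB, mBi, mC, ms1, ms2, ms3]

/-- Generators of intermediate group number 4. -/
def genS4 : List M5 := [mB, mBi, mC, ms1, ms2, ms3, ms4]

/-- Generators of intermediate group number 5. -/
def genS5 : List M5 := [mB, mBi, mC, ms1, ms2, ms3, ms4, ms5]

/-- Generators of intermediate group number 6. -/
def genS6 : List M5 := [mB, mBi, mC, ms1, ms2, ms3, ms4, ms5, ms6]

/-- Generators of intermediate group number 7. -/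
def genS7 : List M5 := [mB, mBi, mC, ms1, ms2, ms3, ms4, ms5, ms6, ms7]

theorem baseL_mem : ∀ X ∈ baseL, InH (Subgroup.closure (listSet genS0)) X := by
  refine InH.of_chkWords (L := genS0) (fun X hX => InH.gen (by decide +kernel) hX) baseL
    [[2],
     [0, 2, 1],
     [0, 0, 2, 1, 1],
     [0, 0, 0, 2, 1, 1, 1],
     [0, 0, 0, 0, 2, 1, 1, 1, 1],
     [0, 0, 0, 0, 0, 2, 1, 1, 1, 1, 1],
     [0, 0, 0, 0, 0, 0, 2, 1, 1, 1, 1, 1, 1],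
     [0, 0, 0, 0, 0, 0, 0, 2, 1, 1, 1, 1, 1, 1, 1],
     [0, 0, 0, 0, 0, 0, 0, 0, 2, 1, 1, 1, 1, 1, 1, 1, 1],
     [0, 0, 0, 0, 0, 0, 0, 0, 0, 2, 1, 1, 1, 1, 1, 1, 1, 1, 1],
     [0, 0, 0, 0, 0, 0, 0, 0, 0, 0, 2, 1, 1, 1, 1, 1, 1, 1, 1, 1, 1],
     [0, 0, 0, 0, 0, 0, 0, 0, 0, 0, 0, 2, 1, 1, 1, 1, 1, 1, 1, 1, 1, 1, 1],
     [0],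
     [0, 0],
     [0, 0, 0],
     [0, 0, 0, 0],
     [0, 0, 0, 0, 0],
     [0, 0, 0, 0, 0, 0],
     [0, 0, 0, 0, 0, 0, 0],
     [0, 0, 0, 0, 0, 0, 0, 0],
     [0, 0, 0, 0, 0, 0, 0, 0, 0],
     [0, 0, 0, 0, 0, 0, 0, 0, 0, 0],
     [0, 0, 0, 0, 0, 0, 0, 0, 0, 0, 0]] ?_
  decide +kernel

theorem lettersS {S : List M5} (hS : chkInv S = true) (h0 : ∀ X ∈ genS0, X ∈ S) :
    ∀ X ∈ baseL ++ S, InH (Subgroup.closure (listSet S)) X := by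
  intro X hX
  rcases List.mem_append.mp hX with hX | hX
  · exact (baseL_mem X hX).mono (closure_listSet_le fun Y hY => InH.gen hS (h0 Y hY))
  · exact InH.gen hS hX

theorem letters0 : ∀ X ∈ baseL ++ genS0, InH (Subgroup.closure (listSet genS0)) X :=
  lettersS (by decide +kernel) (by simp [genS0, genS0])

theorem letters1 : ∀ X ∈ baseL ++ genS1, InH (Subgroup.closure (listSet genS1)) X :=
  lettersS (by decide +kernel) (by simp [genS0, genS1])

theorem letters2 : ∀ X ∈ baseL ++ genS2, InH (Subgroup.closure (listSet genS2)) X :=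
  lettersS (by decide +kernel) (by simp [genS0, genS2])

theorem letters3 : ∀ X ∈ baseL ++ genS3, InH (Subgroup.closure (listSet genS3)) X :=
  lettersS (by decide +kernel) (by simp [genS0, genS3])

theorem letters4 : ∀ X ∈ baseL ++ genS4, InH (Subgroup.closure (listSet genS4)) X :=
  lettersS (by decide +kernel) (by simp [genS0, genS4])

theorem letters5 : ∀ X ∈ baseL ++ genS5, InH (Subgroup.closure (listSet genS5)) X :=
  lettersS (by decide +kernel) (by simp [genS0, genS5])

theorem letters6 : ∀ X ∈ baseL ++ genS6, InH (Subgroup.closure (listSet genS6)) X :=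
  lettersS (by decide +kernel) (by simp [genS0, genS6])

theorem letters7 : ∀ X ∈ baseL ++ genS7, InH (Subgroup.closure (listSet genS7)) X :=
  lettersS (by decide +kernel) (by simp [genS0, genS7])

theorem index0 : (Subgroup.closure (listSet genS0)).relIndex
    (Subgroup.closure (listSet genS1)) ≠ 0 := by
  refine relIndex_of_table (L := baseL ++ genS0) (S := genS1)
    [⟨⟨1, 0, 0, 0, 0⟩, ⟨0, 1, 0, 0, 0⟩, ⟨0, 0, 1, 0, 0⟩, ⟨0, 0, 0, 1, 0⟩, ⟨0, 0, 0, 0, -1⟩⟩]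
    letters0 (by decide +kernel)
    [[([12], 0),
      ([22], 0),
      ([0], 0),
      ([], 1)],
     [([12], 1),
      ([22], 1),
      ([6], 1),
      ([], 0)]] ?_
  decide +kernel

theorem index1 : (Subgroup.closure (listSet genS1)).relIndex
    (Subgroup.closure (listSet genS2)) ≠ 0 := by
  refine relIndex_of_table (L := baseL ++ genS1) (S := genS2)
    [⟨⟨0, 1, 0, 0, 0⟩, ⟨1, 0, 0, 0, 0⟩, ⟨0, 0, 0, -1, 0⟩, ⟨0, 0, -1, 0, 0⟩, ⟨0, 0, 0, 0, 1⟩⟩]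
    letters1 (by decide +kernel)
    [[([12], 0),
      ([22], 0),
      ([0], 0),
      ([26], 0),
      ([], 1)],
     [([22], 1),
      ([12], 1),
      ([2], 1),
      ([26], 1),
      ([], 0)]] ?_
  decide +kernel

theorem index2 : (Subgroup.closure (listSet genS2)).relIndex
    (Subgroup.closure (listSet genS3)) ≠ 0 := by
  refine relIndex_of_table (L := baseL ++ genS2) (S := genS3)
    [⟨⟨0, 2, -1, 0, 0⟩, ⟨1, 0, 0, 1, 0⟩, ⟨1, 0, 0, 2, 0⟩, ⟨0, -1, 1, 0, 0⟩, ⟨0, 0, 0, 0, 1⟩⟩,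
     ⟨⟨2, 0, 0, 1, 0⟩, ⟨0, 1, -1, 0, 0⟩, ⟨0, 1, -2, 0, 0⟩, ⟨-1, 0, 0, -1, 0⟩, ⟨0, 0, 0, 0, 1⟩⟩,
     ⟨⟨0, 3, -1, 0, 0⟩, ⟨0, 0, 0, -1, 0⟩, ⟨-1, 0, 0, -3, 0⟩, ⟨0, -1, 0, 0, 0⟩, ⟨0, 0, 0, 0, 1⟩⟩,
     ⟨⟨3, 0, 0, 1, 0⟩, ⟨0, 0, 1, 0, 0⟩, ⟨0, -1, 3, 0, 0⟩, ⟨-1, 0, 0, 0, 0⟩, ⟨0, 0, 0, 0, 1⟩⟩,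
     ⟨⟨0, 3, 1, 0, 0⟩, ⟨1, 0, 0, -2, 0⟩, ⟨1, 0, 0, -3, 0⟩, ⟨0, -2, -1, 0, 0⟩, ⟨0, 0, 0, 0, -1⟩⟩,
     ⟨⟨3, 0, 0, -1, 0⟩, ⟨0, 1, 2, 0, 0⟩, ⟨0, 1, 3, 0, 0⟩, ⟨-2, 0, 0, 1, 0⟩, ⟨0, 0, 0, 0, -1⟩⟩,
     ⟨⟨0, 2, 3, 0, 0⟩, ⟨2, 0, 0, -1, 0⟩, ⟨3, 0, 0, -2, 0⟩, ⟨0, -1, -2, 0, 0⟩, ⟨0, 0, 0, 0, -1⟩⟩,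
     ⟨⟨0, 3, 2, 0, 0⟩, ⟨-1, 0, 0, 2, 0⟩, ⟨-2, 0, 0, 3, 0⟩, ⟨0, -2, -1, 0, 0⟩, ⟨0, 0, 0, 0, 1⟩⟩,
     ⟨⟨0, 7, -4, 0, 0⟩, ⟨3, 0, 0, 5, 0⟩, ⟨4, 0, 0, 7, 0⟩, ⟨0, -5, 3, 0, 0⟩, ⟨0, 0, 0, 0, -1⟩⟩,
     ⟨⟨5, 0, 0, 7, 0⟩, ⟨0, -4, 3, 0, 0⟩, ⟨0, -7, 5, 0, 0⟩, ⟨-3, 0, 0, -4, 0⟩, ⟨0, 0, 0, 0, 1⟩⟩,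
     ⟨⟨5, 0, 0, 8, 0⟩, ⟨0, 5, -3, 0, 0⟩, ⟨0, 8, -5, 0, 0⟩, ⟨-3, 0, 0, -5, 0⟩, ⟨0, 0, 0, 0, -1⟩⟩]
    letters2 (by decide +kernel)
    [[([12], 0),
      ([22], 0),
      ([0], 0),
      ([26], 0),
      ([27], 0),
      ([], 1)],
     [([14], 8),
      ([], 6),
      ([5, 7, 8, 6, 8, 7, 5], 1),
      ([26], 1),
      ([], 2),
      ([], 0)],
     [([], 5),
      ([], 7),
      ([6, 7, 10, 7, 6], 2),
      ([26], 2),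
      ([], 1),
      ([], 3)],
     [([22, 1, 2, 7, 8, 4, 3, 10, 9], 3),
      ([12, 11, 0, 5, 6, 4, 3, 10, 9], 3),
      ([10, 9, 10, 9, 10, 9, 10, 9, 10], 3),
      ([26], 3),
      ([], 4),
      ([], 2)],
     [([12, 11, 0, 5, 6, 4, 3, 10, 9], 4),
      ([22, 1, 2, 7, 8, 4, 3, 10, 9], 4),
      ([0, 10, 9, 10, 9, 10, 0, 22, 9, 7, 6, 7, 1, 2, 5, 6, 2, 1, 12], 4),
      ([26], 4),
      ([], 3),
      ([22, 1, 2, 6, 5, 17, 1, 2, 9, 10, 1, 2, 27], 5)],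
     [([20], 7),
      ([], 2),
      ([8, 7, 5, 7, 8], 5),
      ([26], 5),
      ([], 6),
      ([1, 0, 1, 3, 4, 5, 6, 5, 7, 8, 14, 0, 1, 3, 2, 6, 7, 13, 27], 4)],
     [([], 1),
      ([], 8),
      ([3, 4, 7, 4, 3], 6),
      ([26], 6),
      ([], 5),
      ([], 9)],
     [([], 2),
      ([14], 5),
      ([8, 10, 11, 9, 11, 10, 8], 7),
      ([26], 7),
      ([14], 8),
      ([], 11)],
     [([], 6),
      ([20], 1),
      ([5, 4, 2, 4, 5], 8),
      ([26], 8),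
      ([20], 7),
      ([], 10)],
     [([1, 0, 1, 3, 4, 5, 6, 5, 7, 8, 3, 4, 2, 1, 22, 0, 1, 3, 2, 7, 6, 3, 2, 13], 9),
      ([1, 0, 1, 3, 4, 5, 6, 5, 7, 8, 4, 6, 2, 1, 2, 10, 9, 10, 9, 10, 9, 10, 9, 10, 2, 22, 1, 0, 1, 5, 4, 1, 0], 9),
      ([3, 6, 4, 3, 4, 5, 4, 10, 5, 22, 5, 4, 21, 5, 7, 8, 4, 3, 4, 3, 4, 3, 4, 3, 4, 8, 7, 4, 3, 11, 10, 7, 6, 14], 9),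
      ([26], 9),
      ([1, 0, 1, 3, 4, 5, 6, 5, 7, 8, 3, 4, 14, 27, 2, 1, 3, 4, 11, 0, 10, 9], 10),
      ([], 6)],
     [([1, 0, 1, 3, 4, 5, 6, 5, 7, 8, 4, 3, 9, 10, 21, 9, 10, 1, 2, 22, 9, 8, 6, 7, 15, 1, 0, 5, 4, 5, 4, 1, 0], 10),
      ([1, 0, 1, 3, 4, 5, 6, 5, 7, 8, 4, 3, 21, 11, 0, 2, 1, 3, 4, 7, 8, 3, 4, 2, 1, 18], 10),
      ([0, 1, 4, 5, 1, 0, 1, 4, 5, 11, 10, 7, 6, 10, 11, 10, 7, 2, 0, 11, 0, 6, 7, 10, 11], 10),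
      ([26], 10),
      ([1, 0, 1, 3, 4, 5, 6, 5, 7, 8, 4, 3, 9, 10, 21, 3, 4, 22, 4, 5, 0, 1, 4, 5, 27], 9),
      ([], 8)],
     [([1, 0, 1, 3, 4, 5, 6, 5, 7, 8, 4, 3, 4, 3, 9, 10, 2, 1, 2, 1, 11, 0, 7, 8, 6, 5, 22], 11),
      ([1, 0, 1, 3, 4, 5, 6, 5, 7, 8, 4, 3, 4, 3, 9, 10, 9, 10, 0, 11, 10, 9, 21, 5, 6, 7, 8, 7, 8, 22, 5, 4, 21, 0, 1, 21, 6, 7, 2, 3, 7, 6, 3, 2, 13], 11),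
      ([5, 1, 0, 1, 0, 3, 0, 1, 0, 1, 5], 11),
      ([26], 11),
      ([1, 0, 1, 3, 4, 5, 6, 5, 7, 8, 4, 3, 4, 3, 4, 3, 4, 3, 9, 10, 9, 10, 9, 10, 21, 1, 2, 9, 10, 21, 11, 0, 21, 3, 4, 11, 0, 2, 1, 3, 4, 19, 27], 11),
      ([], 7)]] ?_
  decide +kernel

theorem index3 : (Subgroup.closure (listSet genS3)).relIndex
    (Subgroup.closure (listSet genS4)) ≠ 0 := by
  refine relIndex_of_table (L := baseL ++ genS3) (S := genS4)
    [⟨⟨0, -1, 0, 0, 0⟩, ⟨-1, 0, 0, 0, 0⟩, ⟨0, 0, 0, -1, 0⟩, ⟨0, 0, -1, 0, 0⟩, ⟨0, 0, 0, 0, -1⟩⟩,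
     ⟨⟨-1, 0, 0, 0, 0⟩, ⟨0, -1, -1, 0, 0⟩, ⟨0, 0, -1, 0, 0⟩, ⟨1, 0, 0, -1, 0⟩, ⟨0, 0, 0, 0, 1⟩⟩,
     ⟨⟨-1, 0, 0, 1, 0⟩, ⟨0, -1, 0, 0, 0⟩, ⟨0, -1, -1, 0, 0⟩, ⟨0, 0, 0, -1, 0⟩, ⟨0, 0, 0, 0, 1⟩⟩]
    letters3 (by decide +kernel)
    [[([12], 0),
      ([22], 0),
      ([0], 0),
      ([26], 0),
      ([27], 0),
      ([28], 0),
      ([], 1)],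
     [([], 3),
      ([], 2),
      ([7, 8, 7], 1),
      ([26], 1),
      ([27], 1),
      ([12, 27, 28, 27], 2),
      ([], 0)],
     [([], 1),
      ([20], 3),
      ([4, 3, 4], 2),
      ([26], 2),
      ([27], 3),
      ([27, 28, 12, 27], 1),
      ([17, 26, 27, 28, 27], 2)],
     [([14], 2),
      ([], 1),
      ([7], 3),
      ([26], 3),
      ([27], 2),
      ([28, 27, 28, 27, 28], 3),
      ([17, 26, 28], 3)]] ?_
  decide +kernel

theorem index4 : (Subgroup.closure (listSet genS4)).relIndex
    (Subgroup.closure (listSet genS5)) ≠ 0 := by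
  refine relIndex_of_table (L := baseL ++ genS4) (S := genS5)
    [⟨⟨1, 0, 0, 0, 0⟩, ⟨0, 1, 0, -2, 0⟩, ⟨-2, 0, -1, 0, 0⟩, ⟨0, 0, 0, -1, 0⟩, ⟨0, 0, 0, 0, 1⟩⟩,
     ⟨⟨0, -1, 0, 0, 0⟩, ⟨-1, 0, 2, 0, 0⟩, ⟨0, 2, 0, 1, 0⟩, ⟨0, 0, 1, 0, 0⟩, ⟨0, 0, 0, 0, -1⟩⟩,
     ⟨⟨0, -1, 0, 2, 0⟩, ⟨-5, 0, -2, 0, 0⟩, ⟨0, 2, 0, -5, 0⟩, ⟨-2, 0, -1, 0, 0⟩, ⟨0, 0, 0, 0, -1⟩⟩]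
    letters4 (by decide +kernel)
    [[([12], 0),
      ([22], 0),
      ([0], 0),
      ([26], 0),
      ([27], 0),
      ([28], 0),
      ([29], 0),
      ([], 1)],
     [([29, 22], 2),
      ([29, 12], 2),
      ([9, 10, 0, 10, 9], 1),
      ([26], 1),
      ([26, 27, 21, 29, 18, 1, 0, 7, 6, 28, 29, 16], 2),
      ([13, 28, 29, 21], 2),
      ([], 2),
      ([], 0)],
     [([22, 29], 1),
      ([12, 29], 1),
      ([2, 1, 2, 1, 2], 2),
      ([26], 2),
      ([26, 27, 21, 29, 18, 1, 0, 7, 6, 28, 29, 16], 1),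
      ([13, 29, 28, 21], 1),
      ([], 1),
      ([], 3)],
     [([22, 3, 29, 8, 22, 7, 29, 0, 22, 29, 22, 7, 29, 0, 22, 29, 22, 29, 22, 2, 1, 29, 22, 27, 28, 27, 28, 20, 0, 1, 3, 5, 29, 11, 0], 3),
      ([29, 21, 29, 22, 3, 29, 8, 22, 7, 29, 0, 22, 29, 22, 7, 29, 0, 22, 29, 22, 29, 22, 2, 1, 29, 22, 27, 28, 27, 28, 20, 0, 1, 3, 5, 29, 11, 0], 3),
      ([3, 4, 8, 4, 3], 3),
      ([26], 3),
      ([22, 29, 22, 3, 29, 8, 6, 22, 29, 22, 1, 29, 22, 7, 29, 0, 22, 29, 22, 29, 22, 29, 22, 29, 22, 27, 29, 21, 29, 1, 2, 11, 10, 21, 29], 3),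
      ([21, 29, 21, 29, 22, 3, 29, 8, 22, 7, 29, 0, 22, 29, 22, 7, 29, 0, 22, 29, 22, 29, 22, 2, 1, 29, 22, 27, 28, 27, 28, 22, 26, 3, 1, 0, 1, 11, 10, 18], 3),
      ([22, 29, 22, 3, 29, 8, 22, 7, 29, 0, 22, 29, 22, 7, 29, 0, 22, 29, 22, 29, 22, 2, 1, 29, 22, 27, 28, 27, 28, 20, 0, 1, 3, 5, 29, 11, 0], 3),
      ([], 2)]] ?_
  decide +kernel

theorem index5 : (Subgroup.closure (listSet genS5)).relIndex
    (Subgroup.closure (listSet genS6)) ≠ 0 := by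
  refine relIndex_of_table (L := baseL ++ genS5) (S := genS6)
    [⟨⟨0, -1, 0, 1, 0⟩, ⟨0, 0, 1, 0, 0⟩, ⟨0, 1, 0, 0, 0⟩, ⟨1, 0, 1, 0, 0⟩, ⟨0, 0, 0, 0, 1⟩⟩,
     ⟨⟨-1, 0, -1, 0, 0⟩, ⟨0, 0, 0, -1, 0⟩, ⟨1, 0, 0, 0, 0⟩, ⟨0, 1, 0, -1, 0⟩, ⟨0, 0, 0, 0, 1⟩⟩]
    letters5 (by decide +kernel)
    [[([12], 0),
      ([22], 0),
      ([0], 0),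
      ([26], 0),
      ([27], 0),
      ([28], 0),
      ([29], 0),
      ([30], 0),
      ([], 1)],
     [([22, 26, 27, 29, 30, 27], 2),
      ([12, 26, 27, 29, 30, 27], 2),
      ([10], 1),
      ([26], 1),
      ([], 2),
      ([26, 27, 28, 29, 30, 27], 2),
      ([26, 27, 30, 27], 2),
      ([30], 1),
      ([], 0)],
     [([12, 26, 27, 29, 30, 27], 1),
      ([22, 26, 27, 29, 30, 27], 1),
      ([8], 2),
      ([26], 2),
      ([], 1),
      ([26, 27, 30, 29, 28, 27], 1),
      ([26, 27, 30, 27], 1),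
      ([26, 27, 29], 2),
      ([27], 2)]] ?_
  decide +kernel

theorem index6 : (Subgroup.closure (listSet genS6)).relIndex
    (Subgroup.closure (listSet genS7)) ≠ 0 := by
  refine relIndex_of_table (L := baseL ++ genS6) (S := genS7)
    [⟨⟨1, 0, 0, 0, 0⟩, ⟨0, 1, 0, 0, 0⟩, ⟨0, 0, 0, 1, 0⟩, ⟨0, 0, 1, 0, 0⟩, ⟨0, 0, 0, 0, -1⟩⟩]
    letters6 (by decide +kernel)
    [[([12], 0),
      ([22], 0),
      ([0], 0),
      ([26], 0),
      ([27], 0),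
      ([28], 0),
      ([29], 0),
      ([30], 0),
      ([31], 0),
      ([], 1)],
     [([14, 26, 31, 27, 29], 1),
      ([20, 26, 27, 31, 29], 1),
      ([1, 0, 1], 1),
      ([26], 1),
      ([27], 1),
      ([17, 26, 31, 29, 31], 1),
      ([29], 1),
      ([27, 28, 29, 13, 29], 1),
      ([27, 29, 19, 29], 1),
      ([], 0)]] ?_
  decide +kernel

theorem index_all : (Subgroup.closure (listSet genS0)).relIndex
    (Subgroup.closure (listSet genS7)) ≠ 0 :=
  Subgroup.relIndex_ne_zero_trans index0 <| Subgroup.relIndex_ne_zero_trans index1 <|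
  Subgroup.relIndex_ne_zero_trans index2 <| Subgroup.relIndex_ne_zero_trans index3 <|
  Subgroup.relIndex_ne_zero_trans index4 <| Subgroup.relIndex_ne_zero_trans index5 index6

/-- Elementary isometry `e1e2`. -/
def el_e1e2 : M5 :=
  ⟨⟨1, 0, 0, -1, 0⟩, ⟨0, 1, 0, 0, 0⟩, ⟨0, 1, 1, 0, 0⟩, ⟨0, 0, 0, 1, 0⟩, ⟨0, 0, 0, 0, 1⟩⟩

/-- Elementary isometry `e1f2`. -/
def el_e1f2 : M5 :=
  ⟨⟨1, 0, -1, 0, 0⟩, ⟨0, 1, 0, 0, 0⟩, ⟨0, 0, 1, 0, 0⟩, ⟨0, 1, 0, 1, 0⟩, ⟨0, 0, 0, 0, 1⟩⟩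

/-- Elementary isometry `f1e2`. -/
def el_f1e2 : M5 :=
  ⟨⟨1, 0, 0, 0, 0⟩, ⟨0, 1, 0, -1, 0⟩, ⟨1, 0, 1, 0, 0⟩, ⟨0, 0, 0, 1, 0⟩, ⟨0, 0, 0, 0, 1⟩⟩

/-- Elementary isometry `f1f2`. -/
def el_f1f2 : M5 :=
  ⟨⟨1, 0, 0, 0, 0⟩, ⟨0, 1, -1, 0, 0⟩, ⟨0, 0, 1, 0, 0⟩, ⟨1, 0, 0, 1, 0⟩, ⟨0, 0, 0, 0, 1⟩⟩

/-- Elementary isometry `e1w`. -/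
def el_e1w : M5 :=
  ⟨⟨1, -6, 0, 0, -6⟩, ⟨0, 1, 0, 0, 0⟩, ⟨0, 0, 1, 0, 0⟩, ⟨0, 0, 0, 1, 0⟩, ⟨0, 2, 0, 0, 1⟩⟩

/-- Elementary isometry `f1w`. -/
def el_f1w : M5 :=
  ⟨⟨1, 0, 0, 0, 0⟩, ⟨-6, 1, 0, 0, -6⟩, ⟨0, 0, 1, 0, 0⟩, ⟨0, 0, 0, 1, 0⟩, ⟨2, 0, 0, 0, 1⟩⟩

/-- Elementary isometry `e2w`. -/
def el_e2w : M5 :=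
  ⟨⟨1, 0, 0, 0, 0⟩, ⟨0, 1, 0, 0, 0⟩, ⟨0, 0, 1, -6, -6⟩, ⟨0, 0, 0, 1, 0⟩, ⟨0, 0, 0, 2, 1⟩⟩

/-- Elementary isometry `sw1`. -/
def el_sw1 : M5 :=
  ⟨⟨0, 1, 0, 0, 0⟩, ⟨1, 0, 0, 0, 0⟩, ⟨0, 0, 1, 0, 0⟩, ⟨0, 0, 0, 1, 0⟩, ⟨0, 0, 0, 0, 1⟩⟩

/-- Elementary isometry `sw2`. -/
def el_sw2 : M5 :=
  ⟨⟨1, 0, 0, 0, 0⟩, ⟨0, 1, 0, 0, 0⟩, ⟨0, 0, 0, 1, 0⟩, ⟨0, 0, 1, 0, 0⟩, ⟨0, 0, 0, 0, 1⟩⟩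

/-- Elementary isometry `perm`. -/
def el_perm : M5 :=
  ⟨⟨0, 0, 1, 0, 0⟩, ⟨0, 0, 0, 1, 0⟩, ⟨1, 0, 0, 0, 0⟩, ⟨0, 1, 0, 0, 0⟩, ⟨0, 0, 0, 0, 1⟩⟩

/-- Elementary isometry `neg1`. -/
def el_neg1 : M5 :=
  ⟨⟨-1, 0, 0, 0, 0⟩, ⟨0, -1, 0, 0, 0⟩, ⟨0, 0, 1, 0, 0⟩, ⟨0, 0, 0, 1, 0⟩, ⟨0, 0, 0, 0, 1⟩⟩

/-- Elementary isometry `neg2`. -/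
def el_neg2 : M5 :=
  ⟨⟨1, 0, 0, 0, 0⟩, ⟨0, 1, 0, 0, 0⟩, ⟨0, 0, -1, 0, 0⟩, ⟨0, 0, 0, -1, 0⟩, ⟨0, 0, 0, 0, 1⟩⟩

/-- Elementary isometry `rw`. -/
def el_rw : M5 :=
  ⟨⟨1, 0, 0, 0, 0⟩, ⟨0, 1, 0, 0, 0⟩, ⟨0, 0, 1, 0, 0⟩, ⟨0, 0, 0, 1, 0⟩, ⟨0, 0, 0, 0, -1⟩⟩

/-- Elementary isometry `R`. -/
def el_R : M5 :=
  ⟨⟨3, -2, 0, 0, -6⟩, ⟨-2, 3, 0, 0, 6⟩, ⟨0, 0, 1, 0, 0⟩, ⟨0, 0, 0, 1, 0⟩, ⟨2, -2, 0, 0, -5⟩⟩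

theorem el_e1e2_mem : InH (Subgroup.closure (listSet genS7)) el_e1e2 :=
  InH.of_word letters7 [29, 18] (by decide +kernel)

theorem el_e1f2_mem : InH (Subgroup.closure (listSet genS7)) el_e1f2 :=
  InH.of_word letters7 [26, 31, 14, 27] (by decide +kernel)

theorem el_f1e2_mem : InH (Subgroup.closure (listSet genS7)) el_f1e2 :=
  InH.of_word letters7 [20, 26, 31, 27] (by decide +kernel)

theorem el_f1f2_mem : InH (Subgroup.closure (listSet genS7)) el_f1f2 :=
  InH.of_word letters7 [18, 29] (by decide +kernel)

theorem el_e1w_mem : InH (Subgroup.closure (listSet genS7)) el_e1w :=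
  InH.of_word letters7 [1, 0, 28, 30, 21, 27] (by decide +kernel)

theorem el_f1w_mem : InH (Subgroup.closure (listSet genS7)) el_f1w :=
  InH.of_word letters7 [1, 2, 27, 28, 30, 21] (by decide +kernel)

theorem el_e2w_mem : InH (Subgroup.closure (listSet genS7)) el_e2w :=
  InH.of_word letters7 [20, 1, 0, 28, 30, 18, 27] (by decide +kernel)

theorem el_sw1_mem : InH (Subgroup.closure (listSet genS7)) el_sw1 :=
  InH.of_word letters7 [17, 29, 32] (by decide +kernel)

theorem el_sw2_mem : InH (Subgroup.closure (listSet genS7)) el_sw2 :=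
  InH.of_word letters7 [26, 32] (by decide +kernel)

theorem el_perm_mem : InH (Subgroup.closure (listSet genS7)) el_perm :=
  InH.of_word letters7 [20, 27, 29] (by decide +kernel)

theorem el_neg1_mem : InH (Subgroup.closure (listSet genS7)) el_neg1 :=
  InH.of_word letters7 [26, 27, 29] (by decide +kernel)

theorem el_neg2_mem : InH (Subgroup.closure (listSet genS7)) el_neg2 :=
  InH.of_word letters7 [17, 26, 27, 29] (by decide +kernel)

theorem el_rw_mem : InH (Subgroup.closure (listSet genS7)) el_rw :=
  InH.of_word letters7 [26] (by decide +kernel)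

theorem el_R_mem : InH (Subgroup.closure (listSet genS7)) el_R :=
  InH.of_word letters7 [10] (by decide +kernel)

/-! ### The orthogonal group of `2 x₁ y₁ + 2 x₂ y₂ + 3 w²` -/

/-- The Gram matrix of `U ⊕ U ⊕ ⟨3⟩`. -/
def matJ : Matrix (Fin 5) (Fin 5) ℤ :=
  !![(0 : ℤ), 1, 0, 0, 0; 1, 0, 0, 0, 0; 0, 0, 0, 1, 0; 0, 0, 1, 0, 0; 0, 0, 0, 0, 3]

/-- The bilinear form of `matJ`. -/
def bil (u v : Fin 5 → ℤ) : ℤ :=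
  u 0 * v 1 + u 1 * v 0 + u 2 * v 3 + u 3 * v 2 + 3 * (u 4 * v 4)

theorem bil_eq (u v : Fin 5 → ℤ) : bil u v = u ⬝ᵥ (matJ *ᵥ v) := by
  simp [bil, matJ, dotProduct, mulVec, Fin.sum_univ_five]
  ring

theorem bil_map {g : GL (Fin 5) ℤ} (hg : g ∈ orthogonalSubgroup matJ) (u v : Fin 5 → ℤ) :
    bil (g.val *ᵥ u) (g.val *ᵥ v) = bil u v := by
  have hg' : (g.val)ᵀ * matJ * g.val = matJ := hg
  rw [bil_eq, bil_eq, ← Matrix.vecMul_transpose, ← Matrix.dotProduct_mulVec,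
    Matrix.mulVec_mulVec, Matrix.mulVec_mulVec, hg']

theorem M5.mulVec (X : M5) (a b c d e : ℤ) : X.toMat *ᵥ ![a, b, c, d, e] =
    ![X.p.a * a + X.p.b * b + X.p.c * c + X.p.d * d + X.p.e * e,
      X.q.a * a + X.q.b * b + X.q.c * c + X.q.d * d + X.q.e * e,
      X.r.a * a + X.r.b * b + X.r.c * c + X.r.d * d + X.r.e * e,
      X.s.a * a + X.s.b * b + X.s.c * c + X.s.d * d + X.s.e * e,
      X.t.a * a + X.t.b * b + X.t.c * c + X.t.d * d + X.t.e * e] := by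
  ext i
  fin_cases i <;> simp [M5.toMat, Matrix.mulVec, dotProduct, Fin.sum_univ_five]

/-- `v` is in the `K`-orbit of `u`. -/
def Reach (K : Subgroup (GL (Fin 5) ℤ)) (u v : Fin 5 → ℤ) : Prop :=
  ∃ k ∈ K, k.val *ᵥ u = v

theorem Reach.refl (K : Subgroup (GL (Fin 5) ℤ)) (u : Fin 5 → ℤ) : Reach K u u :=
  ⟨1, K.one_mem, by simp⟩

theorem Reach.trans {K : Subgroup (GL (Fin 5) ℤ)} {u v w : Fin 5 → ℤ} (h1 : Reach K u v)
    (h2 : Reach K v w) : Reach K u w := by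
  obtain ⟨k, hk, e⟩ := h1
  obtain ⟨l, hl, f⟩ := h2
  exact ⟨l * k, K.mul_mem hl hk, by rw [Units.val_mul, ← Matrix.mulVec_mulVec, e, f]⟩

theorem Reach.symm {K : Subgroup (GL (Fin 5) ℤ)} {u v : Fin 5 → ℤ} (h1 : Reach K u v) :
    Reach K v u := by
  obtain ⟨k, hk, e⟩ := h1
  exact ⟨k⁻¹, K.inv_mem hk, by rw [← e, Matrix.mulVec_mulVec, Units.inv_mul, Matrix.one_mulVec]⟩

theorem Reach.of {K : Subgroup (GL (Fin 5) ℤ)} {X : M5} (hX : InH K X) {u v : Fin 5 → ℤ}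
    (h : X.toMat *ᵥ u = v) : Reach K u v := by
  obtain ⟨k, hk, e⟩ := hX
  exact ⟨k, hk, by rw [e, h]⟩

theorem Reach.congr {K : Subgroup (GL (Fin 5) ℤ)} {u v w : Fin 5 → ℤ} (h : Reach K u v)
    (e : v = w) : Reach K u w := e ▸ h

theorem Reach.iter {K : Subgroup (GL (Fin 5) ℤ)} (f : ℤ → Fin 5 → ℤ)
    (h : ∀ k, Reach K (f k) (f (k + 1))) (k : ℤ) : Reach K (f 0) (f k) := by
  induction k using Int.induction_on with
  | zero => exact Reach.refl K _
  | succ i ih => exact ih.trans (h _)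
  | pred i ih =>
    refine ih.trans (Reach.symm ?_)
    have := h (-(i : ℤ) - 1)
    rwa [sub_add_cancel] at this

/-- The subgroup fixing a vector. -/
def fixSub (v : Fin 5 → ℤ) : Subgroup (GL (Fin 5) ℤ) where
  carrier := {g | g.val *ᵥ v = v}
  one_mem' := by simp
  mul_mem' := by
    intro a b ha hb
    simp only [Set.mem_ofPred_eq] at ha hb ⊢
    rw [Units.val_mul, ← Matrix.mulVec_mulVec, hb, ha]
  inv_mem' := by
    intro a ha
    simp only [Set.mem_ofPred_eq] at ha ⊢
    conv_lhs => rw [← ha]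
    rw [Matrix.mulVec_mulVec, Units.inv_mul, Matrix.one_mulVec]

theorem InH.fix {K : Subgroup (GL (Fin 5) ℤ)} {X : M5} (hX : InH K X) {v : Fin 5 → ℤ}
    (h : X.toMat *ᵥ v = v) : InH (K ⊓ fixSub v) X := by
  obtain ⟨k, hk, e⟩ := hX
  refine ⟨k, ⟨hk, ?_⟩, e⟩
  change k.val *ᵥ v = v
  rw [e, h]

/-- The subgroup contains the elementary isometries of the `U ⊕ U` part. -/
structure Good (K : Subgroup (GL (Fin 5) ℤ)) : Prop where
  f1e2 : InH K el_f1e2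
  f1f2 : InH K el_f1f2
  perm : InH K el_perm
  sw1 : InH K el_sw1

theorem vec5 {a b c d e a' b' c' d' e' : ℤ} (h1 : a = a') (h2 : b = b') (h3 : c = c')
    (h4 : d = d') (h5 : e = e') : ![a, b, c, d, e] = ![a', b', c', d', e'] := by
  rw [h1, h2, h3, h4, h5]

section moves

variable {K : Subgroup (GL (Fin 5) ℤ)}

theorem mv_f1e2 (h : InH K el_f1e2) (a b c d e k : ℤ) :
    Reach K ![a, b, c, d, e] ![a, b - k * d, c + k * a, d, e] := by
  have := Reach.iter (K := K) (fun k => ![a, b - k * d, c + k * a, d, e])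
    (fun k => Reach.of h (by rw [M5.mulVec]; apply vec5 <;> simp only [el_f1e2] <;> ring)) k
  simpa using this

theorem mv_f1f2 (h : InH K el_f1f2) (a b c d e k : ℤ) :
    Reach K ![a, b, c, d, e] ![a, b - k * c, c, d + k * a, e] := by
  have := Reach.iter (K := K) (fun k => ![a, b - k * c, c, d + k * a, e])
    (fun k => Reach.of h (by rw [M5.mulVec]; apply vec5 <;> simp only [el_f1f2] <;> ring)) k
  simpa using this

theorem mv_e1e2 (h : InH K el_e1e2) (a b c d e k : ℤ) :
    Reach K ![a, b, c, d, e] ![a - k * d, b, c + k * b, d, e] := by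
  have := Reach.iter (K := K) (fun k => ![a - k * d, b, c + k * b, d, e])
    (fun k => Reach.of h (by rw [M5.mulVec]; apply vec5 <;> simp only [el_e1e2] <;> ring)) k
  simpa using this

theorem mv_e1f2 (h : InH K el_e1f2) (a b c d e k : ℤ) :
    Reach K ![a, b, c, d, e] ![a - k * c, b, c, d + k * b, e] := by
  have := Reach.iter (K := K) (fun k => ![a - k * c, b, c, d + k * b, e])
    (fun k => Reach.of h (by rw [M5.mulVec]; apply vec5 <;> simp only [el_e1f2] <;> ring)) k
  simpa using this

theorem mv_f1w (h : InH K el_f1w) (a b c d e k : ℤ) :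
    Reach K ![a, b, c, d, e] ![a, b - 6 * k * e - 6 * k ^ 2 * a, c, d, e + 2 * k * a] := by
  have := Reach.iter (K := K)
    (fun k => ![a, b - 6 * k * e - 6 * k ^ 2 * a, c, d, e + 2 * k * a])
    (fun k => Reach.of h (by rw [M5.mulVec]; apply vec5 <;> simp only [el_f1w] <;> ring)) k
  simpa using this

theorem mv_perm (h : InH K el_perm) (a b c d e : ℤ) :
    Reach K ![a, b, c, d, e] ![c, d, a, b, e] :=
  Reach.of h (by rw [M5.mulVec]; apply vec5 <;> simp only [el_perm] <;> ring)

theorem mv_sw1 (h : InH K el_sw1) (a b c d e : ℤ) :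
    Reach K ![a, b, c, d, e] ![b, a, c, d, e] :=
  Reach.of h (by rw [M5.mulVec]; apply vec5 <;> simp only [el_sw1] <;> ring)

theorem mv_neg1 (h : InH K el_neg1) (a b c d e : ℤ) :
    Reach K ![a, b, c, d, e] ![-a, -b, c, d, e] :=
  Reach.of h (by rw [M5.mulVec]; apply vec5 <;> simp only [el_neg1] <;> ring)

theorem mv_rw (h : InH K el_rw) (a b c d e : ℤ) :
    Reach K ![a, b, c, d, e] ![a, b, c, d, -e] :=
  Reach.of h (by rw [M5.mulVec]; apply vec5 <;> simp only [el_rw] <;> ring)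

theorem natAbs_emod_lt (a : ℤ) {b : ℤ} (hb : b ≠ 0) : (a % b).natAbs < b.natAbs := by
  have h1 := Int.emod_lt_abs a hb
  have h2 := Int.emod_nonneg a hb
  rw [Int.abs_eq_natAbs] at h1
  omega

/-- Euclidean reduction in `U ⊕ U`. -/
theorem core (hK : Good K) (m w : ℤ) : ∀ (n : ℕ) (x y z t : ℤ), x.natAbs = n → x ≠ 0 →
    ∃ x' y', x' ≠ 0 ∧ x'.natAbs ≤ n ∧ x' * y' = x * y + z * t ∧
      Reach K ![m * x, m * y, m * z, m * t, w] ![m * x', m * y', 0, 0, w] := by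
  intro n
  induction n using Nat.strong_induction_on with
  | _ n ih =>
  intro x y z t hn hx
  have hz := Int.emod_def z x
  have ht := Int.emod_def t x
  have r1 : Reach K ![m * x, m * y, m * z, m * t, w]
      ![m * x, m * (y + z / x * t), m * (z % x), m * t, w] := by
    have r := mv_f1e2 hK.f1e2 (m * x) (m * y) (m * z) (m * t) w (-(z / x))
    rw [hz]
    refine Reach.congr r (vec5 rfl ?_ ?_ rfl rfl) <;> ring
  by_cases h1 : z % x = 0
  · rw [h1, mul_zero] at r1
    have r2 : Reach K ![m * x, m * (y + z / x * t), 0, m * t, w]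
        ![m * x, m * (y + z / x * t), 0, m * (t % x), w] := by
      have r := mv_f1f2 hK.f1f2 (m * x) (m * (y + z / x * t)) 0 (m * t) w (-(t / x))
      rw [ht]
      refine Reach.congr r (vec5 rfl ?_ rfl ?_ rfl) <;> ring
    by_cases h2 : t % x = 0
    · rw [h2, mul_zero] at r2
      refine ⟨x, y + z / x * t, hx, hn.le, ?_, r1.trans r2⟩
      rw [h1] at hz
      linear_combination t * hz
    · have hlt := natAbs_emod_lt t hx
      rw [hn] at hlt
      obtain ⟨x', y', hx', hle, he, hr⟩ := ih _ hlt (t % x) 0 x (y + z / x * t) rfl h2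
      refine ⟨x', y', hx', hle.trans hlt.le, ?_, ?_⟩
      · rw [he]
        rw [h1] at hz
        linear_combination t * hz
      · rw [mul_zero] at hr
        exact (r1.trans r2).trans ((mv_perm hK.perm _ _ _ _ _).trans
          ((mv_sw1 hK.sw1 _ _ _ _ _).trans hr))
  · have hlt := natAbs_emod_lt z hx
    rw [hn] at hlt
    obtain ⟨x', y', hx', hle, he, hr⟩ := ih _ hlt (z % x) t x (y + z / x * t) rfl h1
    refine ⟨x', y', hx', hle.trans hlt.le, ?_, ?_⟩
    · rw [he]
      linear_combination t * hz
    · exact r1.trans ((mv_perm hK.perm _ _ _ _ _).trans hr)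

end moves

/-- The big group. -/
abbrev bigK : Subgroup (GL (Fin 5) ℤ) := Subgroup.closure (listSet genS7)

theorem bigK_good : Good bigK := ⟨el_f1e2_mem, el_f1f2_mem, el_perm_mem, el_sw1_mem⟩

/-- Reduction of vectors of norm three. -/
theorem reduce_w_one (w y : ℤ) (h : w ^ 2 + 24 * y = 1) :
    Reach bigK ![6, 6 * y, 0, 0, w] ![0, 0, 0, 0, 1] := by
  -- make `w` one of `±1, ±5`
  have main : ∀ w y : ℤ, w ^ 2 + 24 * y = 1 → (w = 1 ∨ w = 5 ∨ w = 7 ∨ w = 11) →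
      Reach bigK ![6, 6 * y, 0, 0, w] ![0, 0, 0, 0, 1] := by
    have c1 : Reach bigK ![6, 0, 0, 0, 1] ![0, 0, 0, 0, 1] :=
      Reach.of el_e1w_mem (by rw [M5.mulVec]; simp [el_e1w])
    have c5 : Reach bigK ![6, -6, 0, 0, 5] ![0, 0, 0, 0, 1] :=
      (Reach.of (v := ![0, 0, 0, 0, -1]) el_R_mem (by rw [M5.mulVec]; simp [el_R])).trans
        (by simpa using mv_rw el_rw_mem 0 0 0 0 (-1))
    rintro w y h (rfl | rfl | rfl | rfl)
    · obtain rfl : y = 0 := by omega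
      simpa using c1
    · obtain rfl : y = -1 := by omega
      simpa using c5
    · obtain rfl : y = -2 := by omega
      refine (mv_f1w el_f1w_mem 6 (6 * (-2)) 0 0 7 (-1)).trans ?_
      refine (mv_rw el_rw_mem _ _ _ _ _).trans ?_
      norm_num
      simpa using c5
    · obtain rfl : y = -5 := by omega
      refine (mv_f1w el_f1w_mem 6 (6 * (-5)) 0 0 11 (-1)).trans ?_
      refine (mv_rw el_rw_mem _ _ _ _ _).trans ?_
      norm_num
      simpa using c1
  have r := mv_f1w el_f1w_mem 6 (6 * y) 0 0 w (-(w / 12))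
  have e1 : w + 2 * (-(w / 12)) * 6 = w % 12 := by rw [Int.emod_def]; ring
  have e2 : 6 * y - 6 * (-(w / 12)) * w - 6 * (-(w / 12)) ^ 2 * 6 =
      6 * (y + (w / 12) * w - 6 * (w / 12) ^ 2) := by ring
  rw [e1, e2] at r
  refine r.trans (main _ _ ?_ ?_)
  · rw [Int.emod_def]
    linear_combination h
  · have h24 : (w ^ 2) % 24 = 1 := by omega
    have hw : w % 12 = (w % 24) % 12 := by omega
    have h3 : ((w % 24) ^ 2) % 24 = 1 := by rw [← h24, sq, sq, ← Int.mul_emod]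
    have h4 : 0 ≤ w % 24 := Int.emod_nonneg _ (by norm_num)
    have h5 : w % 24 < 24 := Int.emod_lt_of_pos _ (by norm_num)
    rw [hw]
    generalize w % 24 = s at *
    interval_cases s <;> simp_all

theorem reduce_w : ∀ (n : ℕ) (x y z t w : ℤ), x.natAbs = n → x ≠ 0 →
    w ^ 2 + 24 * (x * y + z * t) = 1 →
    Reach bigK ![6 * x, 6 * y, 6 * z, 6 * t, w] ![0, 0, 0, 0, 1] := by
  intro n
  induction n using Nat.strong_induction_on with
  | _ n ih =>
  intro x y z t w hn hx h
  obtain ⟨x', y', hx', hle, he, hr⟩ := core bigK_good 6 w n x y z t hn hx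
  refine hr.trans ?_
  rw [← he] at h
  by_cases h1 : x'.natAbs = 1
  · rcases Int.natAbs_eq x' with h2 | h2
    · rw [h1] at h2
      subst h2
      have := reduce_w_one w y' (by linear_combination h)
      simpa using this
    · rw [h1] at h2
      subst h2
      refine (mv_neg1 el_neg1_mem _ _ _ _ _).trans ?_
      have := reduce_w_one w (-y') (by linear_combination h)
      simpa using this
  · have r1 : Reach bigK ![6 * x', 6 * y', 0, 0, w] ![6 * x', 6 * y', 6 * (-w), 0, w] :=
      Reach.of el_e2w_mem (by rw [M5.mulVec]; simp [el_e2w])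
    have r2 := mv_f1e2 el_f1e2_mem (6 * x') (6 * y') (6 * (-w)) 0 w (-((-w) / x'))
    have e1 : 6 * (-w) + -((-w) / x') * (6 * x') = 6 * ((-w) % x') := by
      rw [Int.emod_def]; ring
    rw [e1, mul_zero, sub_zero] at r2
    have h3 : (-w) % x' ≠ 0 := by
      intro h0
      have d1 : x' ∣ w := (dvd_neg).mp (Int.dvd_of_emod_eq_zero h0)
      have d2 : x' ∣ 1 := by
        rw [← h]
        exact dvd_add (dvd_pow d1 two_ne_zero) (Dvd.dvd.mul_left (Dvd.intro _ rfl) _)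
      exact h1 (Int.isUnit_iff_natAbs_eq.mp (isUnit_of_dvd_one d2))
    have hlt : ((-w) % x').natAbs < n := (natAbs_emod_lt (-w) hx').trans_le hle
    have := ih _ hlt ((-w) % x') 0 x' y' w rfl h3 (by linear_combination h)
    rw [mul_zero] at this
    exact r1.trans (r2.trans ((mv_perm el_perm_mem _ _ _ _ _).trans this))

theorem reduce_w' (x y z t w : ℤ) (h : w ^ 2 + 24 * (x * y + z * t) = 1) :
    Reach bigK ![6 * x, 6 * y, 6 * z, 6 * t, w] ![0, 0, 0, 0, 1] := by
  by_cases hx : x = 0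
  · by_cases hy : y = 0
    · by_cases hz : z = 0
      · by_cases ht : t = 0
        · subst hx hy hz ht
          have hw : w ^ 2 = 1 := by linear_combination h
          rcases (by simpa using hw : w = 1 ∨ w = -1) with rfl | rfl
          · simpa using Reach.refl bigK ![0, 0, 0, 0, 1]
          · simpa using mv_rw el_rw_mem 0 0 0 0 (-1)
        · refine (mv_perm el_perm_mem _ _ _ _ _).trans
            ((mv_sw1 el_sw1_mem _ _ _ _ _).trans (reduce_w _ _ _ _ _ _ rfl ht ?_))
          linear_combination h
      · refine (mv_perm el_perm_mem _ _ _ _ _).trans (reduce_w _ _ _ _ _ _ rfl hz ?_)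
        linear_combination h
    · refine (mv_sw1 el_sw1_mem _ _ _ _ _).trans (reduce_w _ _ _ _ _ _ rfl hy ?_)
      linear_combination h
  · exact reduce_w _ _ _ _ _ _ rfl hx h

/-! ### The big group is the whole orthogonal group of `matJ` -/

/-- Transpose. -/
def M5.tr (X : M5) : M5 :=
  ⟨⟨X.p.a, X.q.a, X.r.a, X.s.a, X.t.a⟩, ⟨X.p.b, X.q.b, X.r.b, X.s.b, X.t.b⟩,
   ⟨X.p.c, X.q.c, X.r.c, X.s.c, X.t.c⟩, ⟨X.p.d, X.q.d, X.r.d, X.s.d, X.t.d⟩,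
   ⟨X.p.e, X.q.e, X.r.e, X.s.e, X.t.e⟩⟩

theorem M5.toMat_tr (X : M5) : X.tr.toMat = X.toMatᵀ := by
  ext i j
  fin_cases i <;> fin_cases j <;> rfl

/-- The Gram matrix as an explicit matrix. -/
def mJ : M5 :=
  ⟨⟨0, 1, 0, 0, 0⟩, ⟨1, 0, 0, 0, 0⟩, ⟨0, 0, 0, 1, 0⟩, ⟨0, 0, 1, 0, 0⟩, ⟨0, 0, 0, 0, 3⟩⟩

theorem mJ_toMat : mJ.toMat = matJ := rfl

theorem bigK_le : bigK ≤ orthogonalSubgroup matJ := by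
  have h : ∀ X ∈ genS7, ((X.tr.mul mJ).mul X).eqb mJ = true :=
    List.all_eq_true.mp (by decide +kernel :
      genS7.all (fun X => ((X.tr.mul mJ).mul X).eqb mJ) = true)
  rw [Subgroup.closure_le]
  rintro g ⟨X, hX, hg⟩
  change (g.val)ᵀ * matJ * g.val = matJ
  rw [hg, ← M5.toMat_tr, ← mJ_toMat, ← M5.toMat_mul, ← M5.toMat_mul, M5.eq_of_eqb (h X hX)]

theorem eta5 (u : Fin 5 → ℤ) : u = ![u 0, u 1, u 2, u 3, u 4] := by
  ext i
  fin_cases i <;> rfl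

/-- Matrices agreeing on the standard basis are equal. -/
theorem mat_ext {X Y : Matrix (Fin 5) (Fin 5) ℤ}
    (h0 : X *ᵥ ![1, 0, 0, 0, 0] = Y *ᵥ ![1, 0, 0, 0, 0])
    (h1 : X *ᵥ ![0, 1, 0, 0, 0] = Y *ᵥ ![0, 1, 0, 0, 0])
    (h2 : X *ᵥ ![0, 0, 1, 0, 0] = Y *ᵥ ![0, 0, 1, 0, 0])
    (h3 : X *ᵥ ![0, 0, 0, 1, 0] = Y *ᵥ ![0, 0, 0, 1, 0])
    (h4 : X *ᵥ ![0, 0, 0, 0, 1] = Y *ᵥ ![0, 0, 0, 0, 1]) : X = Y := by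
  ext i j
  fin_cases j
  · simpa [mulVec, dotProduct, Fin.sum_univ_five] using congrFun h0 i
  · simpa [mulVec, dotProduct, Fin.sum_univ_five] using congrFun h1 i
  · simpa [mulVec, dotProduct, Fin.sum_univ_five] using congrFun h2 i
  · simpa [mulVec, dotProduct, Fin.sum_univ_five] using congrFun h3 i
  · simpa [mulVec, dotProduct, Fin.sum_univ_five] using congrFun h4 i

theorem bil_e1 (u : Fin 5 → ℤ) : bil u ![1, 0, 0, 0, 0] = u 1 := by simp [bil]
theorem bil_f1 (u : Fin 5 → ℤ) : bil u ![0, 1, 0, 0, 0] = u 0 := by simp [bil]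
theorem bil_e2 (u : Fin 5 → ℤ) : bil u ![0, 0, 1, 0, 0] = u 3 := by simp [bil]
theorem bil_f2 (u : Fin 5 → ℤ) : bil u ![0, 0, 0, 1, 0] = u 2 := by simp [bil]
theorem bil_w (u : Fin 5 → ℤ) : bil u ![0, 0, 0, 0, 1] = 3 * u 4 := by simp [bil]

theorem stage4 {g : GL (Fin 5) ℤ} (hg : g ∈ orthogonalSubgroup matJ)
    (hw : g.val *ᵥ ![0, 0, 0, 0, 1] = ![0, 0, 0, 0, 1])
    (he : g.val *ᵥ ![1, 0, 0, 0, 0] = ![1, 0, 0, 0, 0])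
    (hf : g.val *ᵥ ![0, 1, 0, 0, 0] = ![0, 1, 0, 0, 0]) : g ∈ bigK := by
  have a1 := bil_map hg ![0, 0, 1, 0, 0] ![0, 0, 0, 0, 1]
  have a2 := bil_map hg ![0, 0, 1, 0, 0] ![1, 0, 0, 0, 0]
  have a3 := bil_map hg ![0, 0, 1, 0, 0] ![0, 1, 0, 0, 0]
  have b1 := bil_map hg ![0, 0, 0, 1, 0] ![0, 0, 0, 0, 1]
  have b2 := bil_map hg ![0, 0, 0, 1, 0] ![1, 0, 0, 0, 0]
  have b3 := bil_map hg ![0, 0, 0, 1, 0] ![0, 1, 0, 0, 0]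
  have c1 := bil_map hg ![0, 0, 1, 0, 0] ![0, 0, 1, 0, 0]
  have c2 := bil_map hg ![0, 0, 0, 1, 0] ![0, 0, 0, 1, 0]
  have c3 := bil_map hg ![0, 0, 1, 0, 0] ![0, 0, 0, 1, 0]
  rw [hw, bil_w, bil_w] at a1 b1
  rw [he, bil_e1, bil_e1] at a2 b2
  rw [hf, bil_f1, bil_f1] at a3 b3
  rw [bil_e2 ![0, 0, 1, 0, 0]] at c1
  rw [bil_f2 ![0, 0, 0, 1, 0]] at c2
  rw [bil_f2 ![0, 0, 1, 0, 0]] at c3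
  have hu := eta5 (g.val *ᵥ ![0, 0, 1, 0, 0])
  have hv := eta5 (g.val *ᵥ ![0, 0, 0, 1, 0])
  have p1 : (g.val *ᵥ ![0, 0, 1, 0, 0]) 4 = 0 := by simpa using a1
  have q1 : (g.val *ᵥ ![0, 0, 0, 1, 0]) 4 = 0 := by simpa using b1
  have p2 : (g.val *ᵥ ![0, 0, 1, 0, 0]) 1 = 0 := a2
  have q2 : (g.val *ᵥ ![0, 0, 0, 1, 0]) 1 = 0 := b2
  have p3 : (g.val *ᵥ ![0, 0, 1, 0, 0]) 0 = 0 := a3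
  have q3 : (g.val *ᵥ ![0, 0, 0, 1, 0]) 0 = 0 := b3
  rw [p1, p2, p3] at hu
  rw [q1, q2, q3] at hv
  generalize (g.val *ᵥ ![0, 0, 1, 0, 0]) 2 = c at *
  generalize (g.val *ᵥ ![0, 0, 1, 0, 0]) 3 = d at *
  generalize (g.val *ᵥ ![0, 0, 0, 1, 0]) 2 = c' at *
  generalize (g.val *ᵥ ![0, 0, 0, 1, 0]) 3 = d' at *
  rw [hu] at c1 c3
  rw [hv] at c2 c3
  have r1 : c * d = 0 := by
    simp [bil] at c1
    linarith
  have r2 : c' * d' = 0 := by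
    simp [bil] at c2
    linarith
  have r3 : c * d' + d * c' = 1 := by
    simpa [bil] using c3
  have fin : ∀ X : M5, InH bigK X → X.toMat *ᵥ ![0, 0, 0, 0, 1] = ![0, 0, 0, 0, 1] →
      X.toMat *ᵥ ![1, 0, 0, 0, 0] = ![1, 0, 0, 0, 0] →
      X.toMat *ᵥ ![0, 1, 0, 0, 0] = ![0, 1, 0, 0, 0] →
      X.toMat *ᵥ ![0, 0, 1, 0, 0] = ![0, 0, c, d, 0] →
      X.toMat *ᵥ ![0, 0, 0, 1, 0] = ![0, 0, c', d', 0] → g ∈ bigK := by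
    intro X hX x1 x2 x3 x4 x5
    exact hX.mem (mat_ext (he.trans x2.symm) (hf.trans x3.symm) (hu.trans x4.symm)
      (hv.trans x5.symm) (hw.trans x1.symm))
  rcases mul_eq_zero.mp r1 with rfl | rfl
  · have r4 : d * c' = 1 := by linarith
    have hc : c' ≠ 0 := by
      rintro rfl
      simp at r4
    obtain rfl : d' = 0 := (mul_eq_zero.mp r2).resolve_left hc
    rcases Int.mul_eq_one_iff_eq_one_or_neg_one.mp r4 with ⟨rfl, rfl⟩ | ⟨rfl, rfl⟩
    · refine fin el_sw2 el_sw2_mem ?_ ?_ ?_ ?_ ?_ <;> rw [M5.mulVec] <;> apply vec5 <;>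
        simp only [el_sw2] <;> ring
    · refine fin (el_sw2.mul el_neg2) (el_sw2_mem.mul el_neg2_mem) ?_ ?_ ?_ ?_ ?_ <;>
        rw [M5.mulVec] <;> apply vec5 <;>
        simp only [el_sw2, el_neg2, M5.mul, V5.vm] <;> ring
  · have r4 : c * d' = 1 := by linarith
    have hd : d' ≠ 0 := by
      rintro rfl
      simp at r4
    obtain rfl : c' = 0 := (mul_eq_zero.mp r2).resolve_right hd
    rcases Int.mul_eq_one_iff_eq_one_or_neg_one.mp r4 with ⟨rfl, rfl⟩ | ⟨rfl, rfl⟩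
    · refine fin M5.one (InH.one _) ?_ ?_ ?_ ?_ ?_ <;> rw [M5.mulVec] <;> apply vec5 <;>
        simp only [M5.one] <;> ring
    · refine fin el_neg2 el_neg2_mem ?_ ?_ ?_ ?_ ?_ <;> rw [M5.mulVec] <;> apply vec5 <;>
        simp only [el_neg2] <;> ring

theorem stage3 {g : GL (Fin 5) ℤ} (hg : g ∈ orthogonalSubgroup matJ)
    (hw : g.val *ᵥ ![0, 0, 0, 0, 1] = ![0, 0, 0, 0, 1])
    (he : g.val *ᵥ ![1, 0, 0, 0, 0] = ![1, 0, 0, 0, 0]) : g ∈ bigK := by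
  have a1 := bil_map hg ![0, 1, 0, 0, 0] ![0, 0, 0, 0, 1]
  have a2 := bil_map hg ![0, 1, 0, 0, 0] ![1, 0, 0, 0, 0]
  have c1 := bil_map hg ![0, 1, 0, 0, 0] ![0, 1, 0, 0, 0]
  rw [hw, bil_w, bil_w] at a1
  rw [he, bil_e1, bil_e1] at a2
  rw [bil_f1 ![0, 1, 0, 0, 0]] at c1
  have hu := eta5 (g.val *ᵥ ![0, 1, 0, 0, 0])
  have m1 : InH ((bigK ⊓ fixSub ![0, 0, 0, 0, 1]) ⊓ fixSub ![1, 0, 0, 0, 0]) el_e1e2 :=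
    (el_e1e2_mem.fix (by rw [M5.mulVec]; apply vec5 <;> simp only [el_e1e2] <;> ring)).fix
      (by rw [M5.mulVec]; apply vec5 <;> simp only [el_e1e2] <;> ring)
  have m2 : InH ((bigK ⊓ fixSub ![0, 0, 0, 0, 1]) ⊓ fixSub ![1, 0, 0, 0, 0]) el_e1f2 :=
    (el_e1f2_mem.fix (by rw [M5.mulVec]; apply vec5 <;> simp only [el_e1f2] <;> ring)).fix
      (by rw [M5.mulVec]; apply vec5 <;> simp only [el_e1f2] <;> ring)
  have key : Reach ((bigK ⊓ fixSub ![0, 0, 0, 0, 1]) ⊓ fixSub ![1, 0, 0, 0, 0])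
      (g.val *ᵥ ![0, 1, 0, 0, 0]) ![0, 1, 0, 0, 0] := by
    rw [hu]
    simp only [bil] at c1
    generalize g.val *ᵥ ![0, 1, 0, 0, 0] = u at *
    have h4 : u 4 = 0 := by simpa using a1
    have h1 : u 1 = 1 := by simpa using a2
    have h0 : u 0 = - (u 2 * u 3) := by
      rw [h4, h1] at c1
      simp at c1
      linarith
    rw [h4, h1, h0]
    refine ((mv_e1e2 m1 _ _ _ _ _ (-(u 2))).trans (mv_e1f2 m2 _ _ _ _ _ (-(u 3)))).congr ?_
    apply vec5 <;> ring
  obtain ⟨k, ⟨⟨hk, hkw⟩, hke⟩, e⟩ := key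
  have hkw' : k.val *ᵥ ![0, 0, 0, 0, 1] = ![0, 0, 0, 0, 1] := hkw
  have hke' : k.val *ᵥ ![1, 0, 0, 0, 0] = ![1, 0, 0, 0, 0] := hke
  have := stage4 (g := k * g) (Subgroup.mul_mem _ (bigK_le hk) hg)
    (by rw [Units.val_mul, ← Matrix.mulVec_mulVec, hw, hkw'])
    (by rw [Units.val_mul, ← Matrix.mulVec_mulVec, he, hke'])
    (by rw [Units.val_mul, ← Matrix.mulVec_mulVec, e])
  exact (Subgroup.mul_mem_cancel_left _ hk).mp this

theorem red2 (K : Subgroup (GL (Fin 5) ℤ)) (hK : Good K) (hn : InH K el_neg1)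
    (hKJ : K ≤ orthogonalSubgroup matJ) (a b c d : ℤ) (v : Fin 5 → ℤ) (ha : a ≠ 0)
    (h : a * b + c * d = 0) (hv : bil ![a, b, c, d, 0] v = 1) :
    Reach K ![a, b, c, d, 0] ![1, 0, 0, 0, 0] := by
  obtain ⟨x', y', hx', -, he, hr⟩ := core hK 1 0 _ a b c d rfl ha
  simp only [one_mul] at hr
  rw [h] at he
  obtain rfl : y' = 0 := (mul_eq_zero.mp he).resolve_left hx'
  have hx : x' * 1 = 1 ∨ x' * 1 = -1 := by
    obtain ⟨k, hk, e⟩ := hr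
    have := bil_map (hKJ hk) ![a, b, c, d, 0] v
    rw [e, hv] at this
    simp [bil] at this
    rw [mul_one]
    exact Int.isUnit_iff.mp (IsUnit.of_mul_eq_one _ this)
  rw [mul_one] at hx
  rcases hx with rfl | rfl
  · exact hr
  · exact hr.trans (by simpa using mv_neg1 hn (-1) 0 0 0 0)

theorem red2' (K : Subgroup (GL (Fin 5) ℤ)) (hK : Good K) (hn : InH K el_neg1)
    (hKJ : K ≤ orthogonalSubgroup matJ) (a b c d : ℤ) (v : Fin 5 → ℤ)
    (h : a * b + c * d = 0) (hv : bil ![a, b, c, d, 0] v = 1) :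
    Reach K ![a, b, c, d, 0] ![1, 0, 0, 0, 0] := by
  by_cases ha : a = 0
  · by_cases hb : b = 0
    · by_cases hc : c = 0
      · by_cases hd : d = 0
        · subst ha hb hc hd
          simp [bil] at hv
        · refine (mv_perm hK.perm _ _ _ _ _).trans ((mv_sw1 hK.sw1 _ _ _ _ _).trans
            (red2 K hK hn hKJ _ _ _ _ ![v 3, v 2, v 0, v 1, v 4] hd (by linear_combination h) ?_))
          rw [← hv]
          simp [bil]
          ring
      · refine (mv_perm hK.perm _ _ _ _ _).trans
          (red2 K hK hn hKJ _ _ _ _ ![v 2, v 3, v 0, v 1, v 4] hc (by linear_combination h) ?_)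
        rw [← hv]
        simp [bil]
        ring
    · refine (mv_sw1 hK.sw1 _ _ _ _ _).trans
        (red2 K hK hn hKJ _ _ _ _ ![v 1, v 0, v 2, v 3, v 4] hb (by linear_combination h) ?_)
      rw [← hv]
      simp [bil]
      ring
  · exact red2 K hK hn hKJ _ _ _ _ v ha h hv

theorem stage2 {g : GL (Fin 5) ℤ} (hg : g ∈ orthogonalSubgroup matJ)
    (hw : g.val *ᵥ ![0, 0, 0, 0, 1] = ![0, 0, 0, 0, 1]) : g ∈ bigK := by
  have a1 := bil_map hg ![1, 0, 0, 0, 0] ![0, 0, 0, 0, 1]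
  have c1 := bil_map hg ![1, 0, 0, 0, 0] ![1, 0, 0, 0, 0]
  have c2 := bil_map hg ![1, 0, 0, 0, 0] ![0, 1, 0, 0, 0]
  rw [hw, bil_w, bil_w] at a1
  rw [bil_e1 ![1, 0, 0, 0, 0]] at c1
  rw [bil_f1 ![1, 0, 0, 0, 0]] at c2
  have hu := eta5 (g.val *ᵥ ![1, 0, 0, 0, 0])
  have hgood : Good (bigK ⊓ fixSub ![0, 0, 0, 0, 1]) :=
    ⟨el_f1e2_mem.fix (by rw [M5.mulVec]; apply vec5 <;> simp only [el_f1e2] <;> ring),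
     el_f1f2_mem.fix (by rw [M5.mulVec]; apply vec5 <;> simp only [el_f1f2] <;> ring),
     el_perm_mem.fix (by rw [M5.mulVec]; apply vec5 <;> simp only [el_perm] <;> ring),
     el_sw1_mem.fix (by rw [M5.mulVec]; apply vec5 <;> simp only [el_sw1] <;> ring)⟩
  have hneg : InH (bigK ⊓ fixSub ![0, 0, 0, 0, 1]) el_neg1 :=
    el_neg1_mem.fix (by rw [M5.mulVec]; apply vec5 <;> simp only [el_neg1] <;> ring)
  have key : Reach (bigK ⊓ fixSub ![0, 0, 0, 0, 1])
      (g.val *ᵥ ![1, 0, 0, 0, 0]) ![1, 0, 0, 0, 0] := by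
    generalize g.val *ᵥ ![0, 1, 0, 0, 0] = v at *
    generalize g.val *ᵥ ![1, 0, 0, 0, 0] = u at *
    have h4 : u 4 = 0 := by simpa using a1
    rw [h4] at hu
    rw [hu] at c2
    simp only [bil, h4] at c1
    simp at c1
    rw [hu]
    exact red2' _ hgood hneg (inf_le_left.trans bigK_le) _ _ _ _ v (by linarith)
      (by simpa using c2)
  obtain ⟨k, ⟨hk, hkw⟩, e⟩ := key
  have hkw' : k.val *ᵥ ![0, 0, 0, 0, 1] = ![0, 0, 0, 0, 1] := hkw
  have := stage3 (g := k * g) (Subgroup.mul_mem _ (bigK_le hk) hg)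
    (by rw [Units.val_mul, ← Matrix.mulVec_mulVec, hw, hkw'])
    (by rw [Units.val_mul, ← Matrix.mulVec_mulVec, e])
  exact (Subgroup.mul_mem_cancel_left _ hk).mp this

theorem even_last {h : GL (Fin 5) ℤ} (hh : h ∈ orthogonalSubgroup matJ) (v : Fin 5 → ℤ)
    (hv : bil v v = 0) : ∃ x, bil (h.val *ᵥ v) ![0, 0, 0, 0, 1] = 6 * x := by
  have h1 := bil_map hh v v
  rw [hv] at h1
  generalize h.val *ᵥ v = u at *
  rw [bil_w]
  simp only [bil] at h1
  have h2 : Even (3 * (u 4 * u 4)) :=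
    ⟨-(u 0 * u 1 + u 2 * u 3), by linear_combination h1⟩
  have h3 : Even (u 4) := by
    rcases Int.even_mul.mp h2 with h | h
    · exact absurd h (by decide)
    · simpa [Int.even_mul] using h
  obtain ⟨x, hx⟩ := h3
  exact ⟨x, by rw [hx]; ring⟩

theorem le_bigK : orthogonalSubgroup matJ ≤ bigK := by
  intro g hg
  have hu := eta5 (g.val *ᵥ ![0, 0, 0, 0, 1])
  have adj : ∀ v : Fin 5 → ℤ, bil v v = 0 →
      ∃ x, bil (g.val *ᵥ ![0, 0, 0, 0, 1]) v = 6 * x := by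
    intro v hv
    obtain ⟨x, hx⟩ := even_last (Subgroup.inv_mem _ hg) v hv
    refine ⟨x, ?_⟩
    rw [← hx, ← bil_map hg ((g⁻¹).val *ᵥ v), Matrix.mulVec_mulVec, Units.mul_inv, Matrix.one_mulVec]
    simp only [bil]
    ring
  obtain ⟨y, hy⟩ := adj ![1, 0, 0, 0, 0] (by simp [bil])
  obtain ⟨x, hx⟩ := adj ![0, 1, 0, 0, 0] (by simp [bil])
  obtain ⟨t, ht⟩ := adj ![0, 0, 1, 0, 0] (by simp [bil])
  obtain ⟨z, hz⟩ := adj ![0, 0, 0, 1, 0] (by simp [bil])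
  rw [bil_e1] at hy
  rw [bil_f1] at hx
  rw [bil_e2] at ht
  rw [bil_f2] at hz
  have c := bil_map hg ![0, 0, 0, 0, 1] ![0, 0, 0, 0, 1]
  rw [bil_w ![0, 0, 0, 0, 1]] at c
  have key : Reach bigK (g.val *ᵥ ![0, 0, 0, 0, 1]) ![0, 0, 0, 0, 1] := by
    rw [hu, hx, hy, hz, ht]
    apply reduce_w'
    simp only [bil, hx, hy, hz, ht] at c
    simp at c
    linarith
  obtain ⟨k, hk, e⟩ := key
  have := stage2 (g := k * g) (Subgroup.mul_mem _ (bigK_le hk) hg)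
    (by rw [Units.val_mul, ← Matrix.mulVec_mulVec, e])
  exact (Subgroup.mul_mem_cancel_left _ hk).mp this

/-! ### Transfer to the form `matQ` -/

/-- Base change matrix. -/
def mU : M5 :=
  ⟨⟨-1, 0, 0, 0, 1⟩, ⟨0, -1, -1, 0, -1⟩, ⟨0, 0, 0, -1, 1⟩, ⟨0, 0, -1, 0, -1⟩, ⟨1, 0, 0, -1, 1⟩⟩

/-- Inverse base change matrix. -/
def mUi : M5 :=
  ⟨⟨0, 0, -1, 0, 1⟩, ⟨0, -1, 0, 1, 0⟩, ⟨-1, 0, 1, -1, -1⟩, ⟨1, 0, -2, 0, 1⟩, ⟨1, 0, -1, 0, 1⟩⟩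

/-- Three times the inverse of `matQ`. -/
def mW : M5 :=
  ⟨⟨1, 0, 0, -1, 1⟩, ⟨0, 0, 1, 0, -1⟩, ⟨0, 1, -1, 1, 0⟩, ⟨-1, 0, 1, 0, 0⟩, ⟨1, -1, 0, 0, 1⟩⟩

/-- The image of `matA`. -/
def mA : M5 :=
  ⟨⟨0, 1, 0, 0, 0⟩, ⟨1, 0, 0, -1, 0⟩, ⟨0, -2, -2, 3, -6⟩, ⟨0, 3, 3, -2, 6⟩, ⟨0, 2, 2, -2, 5⟩⟩

theorem mU_mul_mUi : mU.toMat * mUi.toMat = 1 := by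
  rw [← M5.toMat_mul, ← M5.toMat_one, M5.eq_of_eqb (by decide +kernel : (mU.mul mUi).eqb M5.one = true)]

theorem mUi_mul_mU : mUi.toMat * mU.toMat = 1 := by
  rw [← M5.toMat_mul, ← M5.toMat_one, M5.eq_of_eqb (by decide +kernel : (mUi.mul mU).eqb M5.one = true)]

theorem mU_conj : mU.toMatᵀ * mW.toMat * mU.toMat = matJ := by
  rw [← M5.toMat_tr, ← M5.toMat_mul, ← M5.toMat_mul, ← mJ_toMat,
    M5.eq_of_eqb (by decide +kernel : ((mU.tr.mul mW).mul mU).eqb mJ = true)]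

theorem mW_mul_matQ : mW.toMat * matQ = 3 := by decide +kernel

theorem matQ_mul_mW : matQ * mW.toMat = 3 := by decide +kernel

/-- The base change matrix as a unit. -/
def unitU : GL (Fin 5) ℤ := ⟨mU.toMat, mUi.toMat, mU_mul_mUi, mUi_mul_mU⟩

/-- The transposed inverse of a unit. -/
def trInv (g : GL (Fin 5) ℤ) : GL (Fin 5) ℤ :=
  ⟨((g⁻¹ : GL (Fin 5) ℤ).val)ᵀ, (g.val)ᵀ,
    by rw [← transpose_mul, Units.mul_inv, transpose_one],
    by rw [← transpose_mul, Units.inv_mul, transpose_one]⟩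

/-- The contragredient representation in the new basis. -/
def phi : GL (Fin 5) ℤ →* GL (Fin 5) ℤ where
  toFun g := unitU⁻¹ * trInv g * unitU
  map_one' := by
    have : trInv 1 = 1 := Units.ext (by simp [trInv])
    rw [this]
    group
  map_mul' x y := by
    have : trInv (x * y) = trInv x * trInv y :=
      Units.ext (by simp only [trInv, _root_.mul_inv_rev, Units.val_mul, transpose_mul])
    rw [this]
    group

theorem phi_injective : Function.Injective phi := by
  intro x y h
  have h1 : unitU⁻¹ * trInv x * unitU = unitU⁻¹ * trInv y * unitU := h
  have h2 : trInv x = trInv y := by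
    simpa using h1
  have h3 : (x.val)ᵀ = (y.val)ᵀ := congrArg (fun u : GL (Fin 5) ℤ => (u⁻¹).val) h2
  exact Units.ext (transpose_injective h3)

theorem phi_val (g : GL (Fin 5) ℤ) :
    (phi g).val = mUi.toMat * ((g⁻¹ : GL (Fin 5) ℤ).val)ᵀ * mU.toMat := rfl

theorem phi_mem {g : GL (Fin 5) ℤ} (hg : g ∈ orthogonalSubgroup matQ) :
    phi g ∈ orthogonalSubgroup matJ := by
  have h : (((g⁻¹ : GL (Fin 5) ℤ).val)ᵀ) * matQ * (g⁻¹ : GL (Fin 5) ℤ).val = matQ :=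
    (orthogonalSubgroup matQ).inv_mem hg
  have e := mU_conj
  have hUU := mU_mul_mUi
  have h3 := mW_mul_matQ
  have h4 := matQ_mul_mW
  change ((phi g).val)ᵀ * matJ * (phi g).val = matJ
  rw [phi_val, transpose_mul, transpose_mul, transpose_transpose, ← e]
  generalize mU.toMat = U at *
  generalize mUi.toMat = V at *
  generalize mW.toMat = W at *
  have hVU : Vᵀ * Uᵀ = 1 := by rw [← transpose_mul, hUU, transpose_one]
  have hH : (g⁻¹ : GL (Fin 5) ℤ).val * g.val = 1 := Units.inv_mul g
  have hH' : g.val * (g⁻¹ : GL (Fin 5) ℤ).val = 1 := Units.mul_inv g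
  generalize (g⁻¹ : GL (Fin 5) ℤ).val = H at *
  -- `H W Hᵀ = W`
  have key : H * W * Hᵀ = W := by
    have k1 : (H * W * Hᵀ) * matQ = 3 := by
      have k2 : Hᵀ * matQ = matQ * g.val := by
        conv_rhs => rw [← h]
        rw [mul_assoc, hH, mul_one]
      rw [mul_assoc, k2, mul_assoc H, ← mul_assoc W, h3]
      rw [show (3 : Matrix (Fin 5) (Fin 5) ℤ) * g.val = g.val * 3 from by
        rw [show (3 : Matrix (Fin 5) (Fin 5) ℤ) = 1 + 1 + 1 by norm_num]; noncomm_ring, ← mul_assoc, hH, one_mul]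
    have k3 : (H * W * Hᵀ) * (matQ * W) = W * (matQ * W) := by
      rw [← mul_assoc, k1, ← mul_assoc, h3]
    rw [h4] at k3
    ext i j
    have := congrFun (congrFun k3 i) j
    rw [show (3 : Matrix (Fin 5) (Fin 5) ℤ) = 1 + 1 + 1 by norm_num] at this
    simp only [mul_add, mul_one, Matrix.add_apply] at this
    omega
  calc Uᵀ * (H * Vᵀ) * (Uᵀ * W * U) * (V * Hᵀ * U)
      = Uᵀ * (H * (Vᵀ * Uᵀ) * W * (U * V) * Hᵀ) * U := by simp only [mul_assoc]
    _ = Uᵀ * W * U := by rw [hVU, hUU, mul_one, mul_one, key]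

/-- The inverse of `matA`. -/
def mAinv : M5 :=
  ⟨⟨1, 1, 0, 0, 0⟩, ⟨-1, 0, 1, 0, 0⟩, ⟨1, 0, 0, 1, 0⟩, ⟨-1, 0, 0, 0, 1⟩, ⟨1, 0, 0, 0, 0⟩⟩

/-- The inverse of `matB`. -/
def mBinv : M5 :=
  ⟨⟨-1, 1, 0, 0, 0⟩, ⟨1, 0, 1, 0, 0⟩, ⟨1, 0, 0, 1, 0⟩, ⟨-1, 0, 0, 0, 1⟩, ⟨-1, 0, 0, 0, 0⟩⟩

theorem inv_val {g : GL (Fin 5) ℤ} {X : Matrix (Fin 5) (Fin 5) ℤ} (h : g.val * X = 1) :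
    (g⁻¹ : GL (Fin 5) ℤ).val = X := by
  calc (g⁻¹ : GL (Fin 5) ℤ).val = (g⁻¹ : GL (Fin 5) ℤ).val * (g.val * X) := by rw [h, mul_one]
    _ = X := by rw [← mul_assoc, Units.inv_mul, one_mul]

theorem phi_A {A : GL (Fin 5) ℤ} (hA : A.val = matA) : (phi A).val = mA.toMat := by
  rw [phi_val, inv_val (X := mAinv.toMat) (by rw [hA]; decide +kernel), ← M5.toMat_tr,
    ← M5.toMat_mul, ← M5.toMat_mul,
    M5.eq_of_eqb (by decide +kernel : ((mUi.mul mAinv.tr).mul mU).eqb mA = true)]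

theorem phi_B {B : GL (Fin 5) ℤ} (hB : B.val = matB) : (phi B).val = mB.toMat := by
  rw [phi_val, inv_val (X := mBinv.toMat) (by rw [hB]; decide +kernel), ← M5.toMat_tr,
    ← M5.toMat_mul, ← M5.toMat_mul,
    M5.eq_of_eqb (by decide +kernel : ((mUi.mul mBinv.tr).mul mU).eqb mB = true)]

theorem genS0_le {A B : GL (Fin 5) ℤ} (hA : A.val = matA) (hB : B.val = matB) :
    Subgroup.closure (listSet genS0) ≤ Subgroup.closure {phi A, phi B} := by
  have iA : InH (Subgroup.closure {phi A, phi B}) mA :=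
    ⟨phi A, Subgroup.subset_closure (by simp), phi_A hA⟩
  have iB : InH (Subgroup.closure {phi A, phi B}) mB :=
    ⟨phi B, Subgroup.subset_closure (by simp), phi_B hB⟩
  have iC : InH (Subgroup.closure {phi A, phi B}) mC := iA.left_div iB (by decide +kernel)
  have iBi : InH (Subgroup.closure {phi A, phi B}) mBi :=
    iB.left_div (InH.one _) (by decide +kernel)
  apply closure_listSet_le
  intro X hX
  simp only [genS0, List.mem_cons, List.not_mem_nil, or_false] at hX
  rcases hX with rfl | rfl | rfl <;> assumption

/-- Case 12 of Theorem 1.2: the hypergeometric group `Γ(f,g)` generated by the companion matrices `A`, `B`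
of `f(x) = x^5 - x^4 + x^3 - x^2 + x - 1` and `g(x) = x^5 + x^4 - x^3 - x^2 + x + 1`
is an arithmetic subgroup of `O_Q(ℤ)`: it preserves `Q`, it is contained in `O_Q(ℤ)`,
and it has finite index in `O_Q(ℤ)`. -/
theorem hypergeometric_group_arithmetic
    (A B : GL (Fin 5) ℤ)
    (hA : (A : Matrix (Fin 5) (Fin 5) ℤ) = matA)
    (hB : (B : Matrix (Fin 5) (Fin 5) ℤ) = matB) :
    matAᵀ * matQ * matA = matQ ∧
    matBᵀ * matQ * matB = matQ ∧
    Subgroup.closure {A, B} ≤ orthogonalSubgroup matQ ∧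
    ((Subgroup.closure {A, B}).subgroupOf (orthogonalSubgroup matQ)).FiniteIndex := by
  have h1 : matAᵀ * matQ * matA = matQ := by decide +kernel
  have h2 : matBᵀ * matQ * matB = matQ := by decide +kernel
  refine ⟨h1, h2, ?_, ?_⟩
  · rw [Subgroup.closure_le]
    rintro g (rfl | rfl)
    · change (g.val)ᵀ * matQ * g.val = matQ
      rw [hA, h1]
    · change (g.val)ᵀ * matQ * g.val = matQ
      rw [hB, h2]
  · have hcl : Subgroup.closure {A, B} =
        (Subgroup.closure {phi A, phi B}).comap phi := by
      rw [← Set.image_pair, ← MonoidHom.map_closure,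
        Subgroup.comap_map_eq_self_of_injective phi_injective]
    have hle : (orthogonalSubgroup matQ).map phi ≤ bigK := by
      rintro _ ⟨g, hg, rfl⟩
      exact le_bigK (phi_mem hg)
    have hne : (Subgroup.closure {phi A, phi B}).relIndex bigK ≠ 0 := fun h0 =>
      index_all (Subgroup.relIndex_eq_zero_of_le_left (genS0_le hA hB) h0)
    have hne2 : (Subgroup.closure {phi A, phi B}).relIndex ((orthogonalSubgroup matQ).map phi)
        ≠ 0 := fun h0 => hne (Subgroup.relIndex_eq_zero_of_le_right hle h0)
    refine ⟨?_⟩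
    change (Subgroup.closure {A, B}).relIndex (orthogonalSubgroup matQ) ≠ 0
    rw [hcl, Subgroup.relIndex_comap]
    exact hne2
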